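/- For the KCIP on the torus Λ(L,d) with parameter p=c/n (d≥3), there exists an integer k₀≥1 depending only on c and d such that, setting K = {x∈{0,1}^V : Σ_v x[v] ≤ k₀}, the following holds: for every C₂>0 there exist constants C₁, C and N such that for all n>N and every starting configuration X_0∈{0,1}^V, P[ Σ_{t=0}^{⌊C₁n³log(n)⌋} 1{X_t∈K} < C₂·n³·log(n) ] ≤ C·n^{−5}. -/

import Mathlib

open scoped Classical
open Finset

noncomputable section

/-- The number of particles (vertices labelled `1`) of a configuration. -/
def numParticles {V : Type*} [Fintype V] (x : V → Bool) : ℕ :=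
  (Finset.univ.filter fun v => x v = true).card

/-- One-step transition kernel of the kinetically constrained Ising process (KCIP)
on the graph `G` with density parameter `p`: a uniformly chosen vertex `v` is updated,
and its label is resampled (to `1` with probability `p`, to `0` otherwise) iff `v` has at
least one neighbour labelled `1`. -/
def kcipKernel {V : Type*} [Fintype V] (G : SimpleGraph V) (p : ℝ) (x y : V → Bool) : ℝ :=
  ((Fintype.card V : ℝ))⁻¹ * ∑ v : V,
    (if ∀ w, w ≠ v → y w = x w then
      (if ∃ u, G.Adj u v ∧ x u = true then (if y v = true then p else 1 - p)
       else (if y v = x v then 1 else 0))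
     else 0)

/-- Probability that the Markov chain with kernel `K` started at `x` produces a
trajectory `(X_0, …, X_T)` lying in the event `A`. -/
def trajProb {Ω : Type*} [Fintype Ω] (K : Ω → Ω → ℝ) (x : Ω) (T : ℕ)
    (A : (Fin (T + 1) → Ω) → Prop) : ℝ :=
  ∑ ω : Fin (T + 1) → Ω,
    if ω 0 = x ∧ A ω then ∏ i : Fin T, K (ω i.castSucc) (ω i.succ) else 0

/-- Expectation of a functional `f` of the trajectory `(X_0, …, X_T)` of the Markov chain
with kernel `K` started at `x`. -/
def trajExp {Ω : Type*} [Fintype Ω] (K : Ω → Ω → ℝ) (x : Ω) (T : ℕ)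
    (f : (Fin (T + 1) → Ω) → ℝ) : ℝ :=
  ∑ ω : Fin (T + 1) → Ω,
    (if ω 0 = x then ∏ i : Fin T, K (ω i.castSucc) (ω i.succ) else 0) * f ω

/-- The `d`-dimensional discrete torus `Z_L^d`: vertices are `Fin d → ZMod L`, with an edge
between `u` and `v` iff `u - v = ± e_i` for some coordinate vector `e_i`. -/
def torusGraph (L d : ℕ) : SimpleGraph (Fin d → ZMod L) :=
  SimpleGraph.fromRel fun u v => ∃ i : Fin d, v = u + fun j => if j = i then (1 : ZMod L) else 0

section Occupation

variable {Ω : Type*} [Fintype Ω]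

/-- A weight `u` that a function `W` can absorb at each step makes the weighted trajectory
expectation of `W` nonincreasing in time. -/
theorem sum_weighted_trajectories_le {K : Ω → Ω → ℝ} {W u : Ω → ℝ} (hK : ∀ x y, 0 ≤ K x y)
    (hu : ∀ x, 0 ≤ u x) (h : ∀ x, u x * ∑ y, K x y * W y ≤ W x) (T : ℕ) (x : Ω) :
    (∑ ω : Fin (T + 1) → Ω, if ω 0 = x then
      (∏ i : Fin T, K (ω i.castSucc) (ω i.succ) * u (ω i.castSucc)) * W (ω (Fin.last T))
      else 0) ≤ W x := by
  induction T generalizing x with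
  | zero =>
    rw [← (Equiv.funUnique (Fin 1) Ω).symm.sum_comp]
    simp [Equiv.funUnique]
  | succ T ih =>
    rw [← (Fin.consEquiv fun _ : Fin (T + 2) => Ω).sum_comp, Fintype.sum_prod_type]
    have key : ∀ (a : Ω) (ω : Fin (T + 1) → Ω),
        (if (Fin.consEquiv fun _ : Fin (T + 2) => Ω) (a, ω) 0 = x then
          (∏ i : Fin (T + 1), K ((Fin.consEquiv fun _ : Fin (T + 2) => Ω) (a, ω) i.castSucc)
            ((Fin.consEquiv fun _ : Fin (T + 2) => Ω) (a, ω) i.succ) *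
            u ((Fin.consEquiv fun _ : Fin (T + 2) => Ω) (a, ω) i.castSucc)) *
            W ((Fin.consEquiv fun _ : Fin (T + 2) => Ω) (a, ω) (Fin.last (T + 1))) else 0) =
        if a = x then ∑ y, (K x y * u x) * (if ω 0 = y then
          (∏ i : Fin T, K (ω i.castSucc) (ω i.succ) * u (ω i.castSucc)) * W (ω (Fin.last T))
          else 0) else 0 := by
      intro a ω
      simp only [Fin.consEquiv_apply, Fin.cons_zero]
      split_ifs with hax
      · subst hax
        rw [Fin.prod_univ_succ]
        simp only [mul_ite, mul_zero, Finset.sum_ite_eq, Finset.mem_univ, if_true,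
          Fin.castSucc_zero, Fin.cons_zero, Fin.cons_succ, ← Fin.succ_castSucc, ← Fin.succ_last]
        ring
      · rfl
    simp only [key]
    rw [Finset.sum_comm]
    simp only [Finset.sum_ite_eq', Finset.mem_univ, if_true]
    rw [Finset.sum_comm]
    simp only [← Finset.mul_sum]
    calc _ ≤ ∑ y, (K x y * u x) * W y :=
          Finset.sum_le_sum fun y _ => mul_le_mul_of_nonneg_left (ih y) (mul_nonneg (hK x y) (hu x))
      _ = u x * ∑ y, K x y * W y := by
          rw [Finset.mul_sum]; exact Finset.sum_congr rfl fun y _ => by ring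
      _ ≤ W x := h x

/-- If `W ≥ 1` contracts by `exp (-a)` outside a set and expands by at most `exp b` inside it,
then the occupation time of the set is rarely small. -/
theorem trajProb_occupation_lt_le {K : Ω → Ω → ℝ} {W : Ω → ℝ} {A : Ω → Prop} {a b s : ℝ}
    (hK : ∀ x y, 0 ≤ K x y) (hW : ∀ x, 1 ≤ W x) (ha : 0 ≤ a) (hb : 0 ≤ b)
    (hout : ∀ x, ¬ A x → ∑ y, K x y * W y ≤ Real.exp (-a) * W x)
    (hin : ∀ x, A x → ∑ y, K x y * W y ≤ Real.exp b * W x) (T : ℕ) (x : Ω) :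
    trajProb K x T (fun ω => (∑ t : Fin (T + 1), if A (ω t) then (1 : ℝ) else 0) < s) ≤
      W x * Real.exp ((a + b) * s - a * T) := by
  set u : Ω → ℝ := fun y => if A y then Real.exp (-b) else Real.exp a with hu
  have hupos : ∀ y, 0 ≤ u y := by intro y; simp only [hu]; split_ifs <;> positivity
  have hstep : ∀ y, u y * ∑ z, K y z * W z ≤ W y := by
    intro y
    by_cases hy : A y
    · calc u y * ∑ z, K y z * W z ≤ Real.exp (-b) * (Real.exp b * W y) := by
            simp only [hu, hy, if_true]; gcongr; exact hin y hy
        _ = W y := by rw [← mul_assoc, ← Real.exp_add]; simp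
    · calc u y * ∑ z, K y z * W z ≤ Real.exp a * (Real.exp (-a) * W y) := by
            simp only [hu, hy, if_false]; gcongr; exact hout y hy
        _ = W y := by rw [← mul_assoc, ← Real.exp_add]; simp
  refine le_trans ?_ (mul_le_mul_of_nonneg_right
    (sum_weighted_trajectories_le hK hupos hstep T x) (Real.exp_nonneg _))
  rw [trajProb, Finset.sum_mul]
  refine Finset.sum_le_sum fun ω _ => ?_
  have hprod : 0 ≤ ∏ i : Fin T, K (ω i.castSucc) (ω i.succ) :=
    Finset.prod_nonneg fun i _ => hK _ _
  by_cases h0 : ω 0 = x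
  · by_cases hs : (∑ t : Fin (T + 1), if A (ω t) then (1 : ℝ) else 0) < s
    · rw [if_pos ⟨h0, hs⟩, if_pos h0, Finset.prod_mul_distrib]
      have hexp : ∏ i : Fin T, u (ω i.castSucc) =
          Real.exp (a * T - (a + b) * ∑ t : Fin T, if A (ω t.castSucc) then (1 : ℝ) else 0) := by
        rw [Finset.mul_sum, show a * (T : ℝ) = ∑ _t : Fin T, a by simp [mul_comm],
          ← Finset.sum_sub_distrib, Real.exp_sum]
        refine Finset.prod_congr rfl fun i _ => ?_
        simp only [hu]
        split_ifs <;> congr 1 <;> ring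
      rw [Fin.sum_univ_castSucc] at hs
      have hlast : (0 : ℝ) ≤ if A (ω (Fin.last T)) then (1 : ℝ) else 0 := by
        split_ifs <;> norm_num
      rw [hexp]
      set c := ∑ t : Fin T, if A (ω t.castSucc) then (1 : ℝ) else 0
      have h1 : 1 ≤ Real.exp (a * T - (a + b) * c) * Real.exp ((a + b) * s - a * T) := by
        rw [← Real.exp_add]
        apply Real.one_le_exp
        nlinarith [add_nonneg ha hb]
      have h2 : 1 ≤ W (ω (Fin.last T)) *
          (Real.exp (a * T - (a + b) * c) * Real.exp ((a + b) * s - a * T)) :=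
        one_le_mul_of_one_le_of_one_le (hW _) h1
      calc _ ≤ (∏ i : Fin T, K (ω i.castSucc) (ω i.succ)) * (W (ω (Fin.last T)) *
          (Real.exp (a * T - (a + b) * c) * Real.exp ((a + b) * s - a * T))) :=
            le_mul_of_one_le_right hprod h2
        _ = _ := by ring
    · rw [if_neg (fun h => hs h.2), if_pos h0]
      refine mul_nonneg (mul_nonneg (Finset.prod_nonneg fun i _ => ?_) ?_) (Real.exp_nonneg _)
      · exact mul_nonneg (hK _ _) (hupos _)
      · exact zero_le_one.trans (hW _)
  · rw [if_neg (fun h => h0 h.1), if_neg h0, zero_mul]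

end Occupation

section Reduction

variable {V : Type*} [DecidableEq V]

/-- Normalized monotone submodular set functions with increments at most one. -/
structure IsRankLike (F : Finset V → ℝ) : Prop where
  empty : F ∅ = 0
  mono : ∀ S T, S ⊆ T → F S ≤ F T
  submod : ∀ S T, F (S ∪ T) + F (S ∩ T) ≤ F S + F T
  insert_le : ∀ v S, F (insert v S) ≤ F S + 1

namespace IsRankLike

variable {F : Finset V → ℝ}

theorem nonneg (hF : IsRankLike F) (S : Finset V) : 0 ≤ F S :=
  hF.empty ▸ hF.mono ∅ S (Finset.empty_subset S)

theorem union_le_add_card (hF : IsRankLike F) (S T : Finset V) : F (S ∪ T) ≤ F S + #T := by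
  induction T using Finset.induction_on with
  | empty => simp
  | insert v T hv ih =>
    rw [Finset.union_insert, Finset.card_insert_of_notMem hv]
    push_cast
    linarith [hF.insert_le v (S ∪ T)]

theorem le_card (hF : IsRankLike F) (S : Finset V) : F S ≤ #S := by
  simpa [hF.empty] using hF.union_le_add_card ∅ S

theorem union_le (hF : IsRankLike F) (S T : Finset V) : F (S ∪ T) ≤ F S + F T := by
  linarith [hF.submod S T, hF.nonneg (S ∩ T)]

theorem le_erase_add_one (hF : IsRankLike F) (S : Finset V) (v : V) :
    F S ≤ F (S.erase v) + 1 :=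
  (hF.mono _ _ (Finset.insert_erase_subset v S)).trans (hF.insert_le v (S.erase v))

/-- Marginal contributions decrease when the set grows. -/
theorem sub_erase_anti (hF : IsRankLike F) {S T : Finset V} {v : V} (hST : S ⊆ T) (hv : v ∈ S) :
    F T - F (T.erase v) ≤ F S - F (S.erase v) := by
  have h := hF.submod (T.erase v) S
  have h1 : T.erase v ∪ S = T := by grind
  have h2 : T.erase v ∩ S = S.erase v := by grind
  rw [h1, h2] at h
  linarith

end IsRankLike

variable (G : SimpleGraph V)

/-- The particles having another particle in their neighbourhood. -/
def crowded (S : Finset V) : Finset V := S.filter fun v => ∃ u ∈ S, G.Adj u v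

variable {G}

theorem mem_crowded {S : Finset V} {v : V} :
    v ∈ crowded G S ↔ v ∈ S ∧ ∃ u ∈ S, G.Adj u v := by simp [crowded]

theorem crowded_subset (S : Finset V) : crowded G S ⊆ S := Finset.filter_subset _ _

theorem crowded_mono {S T : Finset V} (h : S ⊆ T) : crowded G S ⊆ crowded G T := by
  intro v hv
  rw [mem_crowded] at hv ⊢
  exact ⟨h hv.1, hv.2.imp fun u hu => ⟨h hu.1, hu.2⟩⟩

theorem sdiff_crowded_subset_erase {S : Finset V} {v : V} (hv : v ∈ crowded G S) :
    S \ crowded G S ⊆ S.erase v \ crowded G (S.erase v) := by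
  intro u hu
  rw [Finset.mem_sdiff] at hu ⊢
  refine ⟨Finset.mem_erase.2 ⟨fun h => hu.2 (h ▸ hv), hu.1⟩, fun h => hu.2 ?_⟩
  exact crowded_mono (Finset.erase_subset v S) h

variable (G)

/-- The expectation of `F` at the configuration reached from `S` by removing uniformly chosen
crowded particles one at a time until no crowded particle is left. -/
def reduced (F : Finset V → ℝ) (S : Finset V) : ℝ :=
  if (crowded G S).Nonempty then
    (∑ v : crowded G S, reduced F (S.erase v)) / #(crowded G S)
  else F S
termination_by #S
decreasing_by exact Finset.card_erase_lt_of_mem (crowded_subset _ v.2)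

variable {G}

theorem reduced_of_crowded_eq_empty (F : Finset V → ℝ) {S : Finset V} (h : crowded G S = ∅) :
    reduced G F S = F S := by
  rw [reduced]; simp [h]

theorem sum_reduced_erase (F : Finset V → ℝ) (S : Finset V) :
    ∑ v ∈ crowded G S, reduced G F (S.erase v) = #(crowded G S) * reduced G F S := by
  by_cases h : (crowded G S).Nonempty
  · conv_rhs => rw [reduced]
    rw [if_pos h, mul_div_cancel₀ _ (by simpa using h.ne_empty),
      Finset.sum_coe_sort (crowded G S) fun v => reduced G F (S.erase v)]
  · simp [Finset.not_nonempty_iff_eq_empty.1 h]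

/-- To prove a property of `reduced G F S` and `reduced G F' S'` it is enough to treat the case
without crowded particles and to average over removals. -/
theorem reduced_le_reduced {F F' : Finset V → ℝ} {S : Finset V}
    (h : ∀ T, S \ crowded G S ⊆ T → T ⊆ S → F T ≤ F' T) :
    reduced G F S ≤ reduced G F' S := by
  induction S using Finset.strongInduction with
  | H S ih =>
    by_cases hS : crowded G S = ∅
    · rw [reduced_of_crowded_eq_empty _ hS, reduced_of_crowded_eq_empty _ hS]
      exact h S Finset.sdiff_subset subset_rfl
    · have hpos : (0 : ℝ) < #(crowded G S) := by
        exact_mod_cast Finset.card_pos.2 (Finset.nonempty_iff_ne_empty.2 hS)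
      refine le_of_mul_le_mul_left ?_ hpos
      rw [← sum_reduced_erase, ← sum_reduced_erase]
      refine Finset.sum_le_sum fun v hv => ?_
      refine ih _ (Finset.erase_ssubset (crowded_subset _ hv)) fun T h1 h2 => ?_
      exact h T ((sdiff_crowded_subset_erase hv).trans h1) (h2.trans (Finset.erase_subset _ _))

theorem reduced_congr {F F' : Finset V → ℝ} {S : Finset V}
    (h : ∀ T, S \ crowded G S ⊆ T → T ⊆ S → F T = F' T) :
    reduced G F S = reduced G F' S :=
  le_antisymm (reduced_le_reduced fun T h1 h2 => (h T h1 h2).le)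
    (reduced_le_reduced fun T h1 h2 => (h T h1 h2).ge)

theorem reduced_const (c : ℝ) (S : Finset V) : reduced G (fun _ => c) S = c := by
  induction S using Finset.strongInduction with
  | H S ih =>
    by_cases hS : crowded G S = ∅
    · rw [reduced_of_crowded_eq_empty _ hS]
    · have hpos : (0 : ℝ) < #(crowded G S) := by
        exact_mod_cast Finset.card_pos.2 (Finset.nonempty_iff_ne_empty.2 hS)
      refine mul_left_cancel₀ hpos.ne' ?_
      rw [← sum_reduced_erase, Finset.sum_congr rfl fun v hv =>
        ih _ (Finset.erase_ssubset (crowded_subset _ hv))]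
      simp

theorem reduced_add (F F' : Finset V → ℝ) (S : Finset V) :
    reduced G (fun T => F T + F' T) S = reduced G F S + reduced G F' S := by
  induction S using Finset.strongInduction with
  | H S ih =>
    by_cases hS : crowded G S = ∅
    · simp only [reduced_of_crowded_eq_empty _ hS]
    · have hpos : (0 : ℝ) < #(crowded G S) := by
        exact_mod_cast Finset.card_pos.2 (Finset.nonempty_iff_ne_empty.2 hS)
      refine mul_left_cancel₀ hpos.ne' ?_
      rw [mul_add, ← sum_reduced_erase, ← sum_reduced_erase, ← sum_reduced_erase,
        ← Finset.sum_add_distrib]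
      exact Finset.sum_congr rfl fun v hv => ih _ (Finset.erase_ssubset (crowded_subset _ hv))

theorem reduced_const_mul (c : ℝ) (F : Finset V → ℝ) (S : Finset V) :
    reduced G (fun T => c * F T) S = c * reduced G F S := by
  induction S using Finset.strongInduction with
  | H S ih =>
    by_cases hS : crowded G S = ∅
    · simp only [reduced_of_crowded_eq_empty _ hS]
    · have hpos : (0 : ℝ) < #(crowded G S) := by
        exact_mod_cast Finset.card_pos.2 (Finset.nonempty_iff_ne_empty.2 hS)
      refine mul_left_cancel₀ hpos.ne' ?_
      rw [mul_left_comm, ← sum_reduced_erase, ← sum_reduced_erase, Finset.mul_sum]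
      exact Finset.sum_congr rfl fun v hv => ih _ (Finset.erase_ssubset (crowded_subset _ hv))

theorem reduced_sub (F F' : Finset V → ℝ) (S : Finset V) :
    reduced G (fun T => F T - F' T) S = reduced G F S - reduced G F' S := by
  have h := reduced_add (G := G) (fun T => F T - F' T) F' S
  simp only [sub_add_cancel] at h
  linarith

theorem reduced_sum {ι : Type*} (s : Finset ι) (F : ι → Finset V → ℝ) (S : Finset V) :
    reduced G (fun T => ∑ i ∈ s, F i T) S = ∑ i ∈ s, reduced G (F i) S := by
  classical
  induction s using Finset.induction_on with
  | empty => simpa using reduced_const 0 S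
  | insert i s hi ih => simp only [Finset.sum_insert hi, reduced_add, ih]

theorem crowded_insert_of_isolated {S : Finset V} {w : V} (h : ∀ v ∈ S, ¬ G.Adj w v) :
    crowded G (insert w S) = crowded G S := by
  ext v
  simp only [mem_crowded, Finset.mem_insert]
  constructor
  · rintro ⟨rfl | hv, u, rfl | hu, huv⟩
    · exact (G.irrefl huv).elim
    · exact (h u hu huv.symm).elim
    · exact (h v hv huv).elim
    · exact ⟨hv, u, hu, huv⟩
  · rintro ⟨hv, u, hu, huv⟩
    exact ⟨Or.inr hv, u, Or.inr hu, huv⟩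

/-- A particle without neighbours is never removed. -/
theorem reduced_insert_of_isolated (F : Finset V → ℝ) {S : Finset V} {w : V} (hw : w ∉ S)
    (h : ∀ v ∈ S, ¬ G.Adj w v) :
    reduced G F (insert w S) = reduced G (fun T => F (insert w T)) S := by
  induction S using Finset.strongInduction with
  | H S ih =>
    by_cases hS : crowded G S = ∅
    · rw [reduced_of_crowded_eq_empty _ hS,
        reduced_of_crowded_eq_empty _ ((crowded_insert_of_isolated h).trans hS)]
    · have hpos : (0 : ℝ) < #(crowded G S) := by
        exact_mod_cast Finset.card_pos.2 (Finset.nonempty_iff_ne_empty.2 hS)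
      refine mul_left_cancel₀ hpos.ne' ?_
      rw [← sum_reduced_erase]
      conv_lhs => rw [← crowded_insert_of_isolated h, ← sum_reduced_erase]
      rw [crowded_insert_of_isolated h]
      refine Finset.sum_congr rfl fun v hv => ?_
      have hvS := crowded_subset _ hv
      rw [Finset.erase_insert_of_ne (fun e : w = v => hw (e ▸ hvS))]
      exact ih _ (Finset.erase_ssubset hvS) (fun e => hw (Finset.mem_of_mem_erase e))
        fun u hu => h u (Finset.mem_of_mem_erase hu)

theorem reduced_erase_of_isolated (F : Finset V → ℝ) {S : Finset V} {v : V} (hv : v ∈ S)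
    (h : v ∉ crowded G S) :
    reduced G F (S.erase v) = reduced G (fun T => F (T.erase v)) S := by
  have hiso : ∀ u ∈ S.erase v, ¬ G.Adj v u := fun u hu huv =>
    h (mem_crowded.2 ⟨hv, u, Finset.mem_of_mem_erase hu, huv.symm⟩)
  conv_rhs => rw [← Finset.insert_erase hv]
  rw [reduced_insert_of_isolated _ (Finset.notMem_erase v S) hiso]
  refine reduced_congr fun T _ hT => ?_
  rw [Finset.erase_insert fun e => Finset.notMem_erase v S (hT e)]

/-- An upper bound for the expected value of `F` after reducing a star with centre `w` and
leaves `N`, when the rest of the configuration together with the leaves is `S`. -/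
def starBound (F : Finset V → ℝ) (w : V) (N S : Finset V) : ℝ :=
  F S - (∑ v ∈ N, (F (insert w S) - F ((insert w S).erase v))) / 2 +
    (F (insert w S) - F S) / (#N + 1)

theorem IsRankLike.starBound_superharmonic {F : Finset V → ℝ} (hF : IsRankLike F) {w : V}
    {N S : Finset V} (hN : N.Nonempty) (hNS : N ⊆ S) (hw : w ∉ S) :
    F S + ∑ v ∈ N, starBound F w (N.erase v) (S.erase v) ≤ (#N + 1) * starBound F w N S := by
  have hm : (1 : ℝ) ≤ #N := by exact_mod_cast Finset.card_pos.2 hN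
  set δ : V → ℝ := fun v => F (insert w S) - F ((insert w S).erase v) with hδ
  have hterm : ∀ v ∈ N, starBound F w (N.erase v) (S.erase v) ≤
      F S - δ v - (∑ j ∈ N, δ j - δ v) / 2 + (F (insert w S) - F S) / #N := by
    intro v hv
    have hvS := hNS hv
    have hwv : w ≠ v := fun e => hw (e ▸ hvS)
    have hcard : ((#(N.erase v) : ℕ) : ℝ) + 1 = #N := by
      exact_mod_cast Finset.card_erase_add_one hv
    rw [starBound, hcard, ← Finset.erase_insert_of_ne hwv]
    have h1 : δ v ≤ F S - F (S.erase v) := hF.sub_erase_anti (Finset.subset_insert w S) hvS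
    have h2 : ∑ j ∈ N, δ j - δ v ≤ ∑ j ∈ N.erase v, (F ((insert w S).erase v) -
        F (((insert w S).erase v).erase j)) := by
      rw [← Finset.sum_erase_eq_sub hv]
      refine Finset.sum_le_sum fun j hj => ?_
      refine hF.sub_erase_anti (Finset.erase_subset _ _) ?_
      have := hNS (Finset.mem_of_mem_erase hj)
      have := Finset.ne_of_mem_erase hj
      simp_all
    have h3 : F ((insert w S).erase v) = F (insert w S) - δ v := by simp [hδ]
    rw [h3] at h2 ⊢
    have h4 : F (S.erase v) + (F (insert w S) - δ v - F (S.erase v)) / #N ≤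
        F S - δ v + (F (insert w S) - F S) / #N := by
      have h5 : (F S - δ v - F (S.erase v)) / #N ≤ F S - δ v - F (S.erase v) :=
        div_le_self (by linarith) hm
      have h6 : (F (insert w S) - δ v - F (S.erase v)) / #N =
        (F (insert w S) - F S) / #N + (F S - δ v - F (S.erase v)) / #N := by ring
      linarith
    linarith
  have hs : ∑ v ∈ N, (F (insert w S) - F ((insert w S).erase v)) = ∑ v ∈ N, δ v := rfl
  refine (add_le_add_right (Finset.sum_le_sum hterm) _).trans (le_of_eq ?_)
  rw [starBound, hs]
  simp only [ Finset.sum_add_distrib, Finset.sum_sub_distrib, ← Finset.sum_div,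
    Finset.sum_const, nsmul_eq_mul]
  field_simp
  ring

theorem crowded_insert {S : Finset V} {w : V} (hN : (S.filter (G.Adj w)).Nonempty) :
    crowded G (insert w S) = insert w (crowded G S ∪ S.filter (G.Adj w)) := by
  ext v
  simp only [mem_crowded, Finset.mem_insert, Finset.mem_union, Finset.mem_filter]
  obtain ⟨u, hu⟩ := hN
  rw [Finset.mem_filter] at hu
  constructor
  · rintro ⟨rfl | hv, u', rfl | hu', huv⟩
    · exact Or.inl rfl
    · exact Or.inl rfl
    · exact Or.inr (Or.inr ⟨hv, huv⟩)
    · exact Or.inr (Or.inl ⟨hv, u', hu', huv⟩)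
  · rintro (rfl | ⟨hv, u', hu', huv⟩ | ⟨hv, hwv⟩)
    · exact ⟨Or.inl rfl, u, Or.inr hu.1, hu.2.symm⟩
    · exact ⟨Or.inr hv, u', Or.inr hu', huv⟩
    · exact ⟨Or.inr hv, w, Or.inl rfl, hwv⟩

/-- Adding a particle `w` next to isolated particles only. -/
theorem IsRankLike.reduced_insert_le {F : Finset V → ℝ} (hF : IsRankLike F) {S : Finset V} {w : V}
    (hw : w ∉ S) (h : ∀ v ∈ S, G.Adj w v → v ∉ crowded G S) :
    reduced G F (insert w S) ≤ reduced G (starBound F w (S.filter (G.Adj w))) S := by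
  induction S using Finset.strongInduction with
  | H S ih =>
    by_cases hN : (S.filter (G.Adj w)).Nonempty
    swap
    · rw [Finset.not_nonempty_iff_eq_empty] at hN
      rw [reduced_insert_of_isolated _ hw fun v hv => Finset.filter_eq_empty_iff.1 hN hv, hN]
      refine (reduced_congr fun T _ _ => ?_).le
      simp [starBound]
    set N := S.filter (G.Adj w) with hNdef
    have hNS : N ⊆ S := Finset.filter_subset _ _
    have hdisj : Disjoint (crowded G S) N := by
      rw [Finset.disjoint_right]
      intro v hv
      rw [hNdef, Finset.mem_filter] at hv
      exact h v hv.1 hv.2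
    have hwnot : w ∉ crowded G S ∪ N := by
      rw [Finset.mem_union]
      rintro (e | e)
      · exact hw (crowded_subset _ e)
      · exact hw (hNS e)
    have hsum := sum_reduced_erase (G := G) F (insert w S)
    rw [crowded_insert hN, Finset.sum_insert hwnot, Finset.sum_union hdisj,
      Finset.card_insert_of_notMem hwnot, Finset.card_union_of_disjoint hdisj,
      Finset.erase_insert hw] at hsum
    push_cast at hsum
    have hA : ∑ u ∈ crowded G S, reduced G F ((insert w S).erase u) ≤
        #(crowded G S) * reduced G (starBound F w N) S := by
      rw [← sum_reduced_erase]
      refine Finset.sum_le_sum fun u hu => ?_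
      have huS := crowded_subset _ hu
      rw [Finset.erase_insert_of_ne (fun e : w = u => hw (e ▸ huS))]
      have hfil : (S.erase u).filter (G.Adj w) = N := by
        rw [Finset.filter_erase, ← hNdef,
          Finset.erase_eq_of_notMem fun e => Finset.disjoint_left.1 hdisj hu e]
      rw [← hfil]
      refine ih _ (Finset.erase_ssubset huS) (fun e => hw (Finset.mem_of_mem_erase e)) ?_
      exact fun v hv hwv hc => h v (Finset.mem_of_mem_erase hv) hwv
        (crowded_mono (Finset.erase_subset _ _) hc)
    have hB : ∀ v ∈ N, reduced G F ((insert w S).erase v) ≤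
        reduced G (fun T => starBound F w (N.erase v) (T.erase v)) S := by
      intro v hv
      have hvS := hNS hv
      rw [Finset.erase_insert_of_ne (fun e : w = v => hw (e ▸ hvS)),
        ← reduced_erase_of_isolated (starBound F w (N.erase v)) hvS
          (Finset.disjoint_right.1 hdisj hv)]
      have hfil : (S.erase v).filter (G.Adj w) = N.erase v := by
        rw [Finset.filter_erase]
      rw [← hfil]
      refine ih _ (Finset.erase_ssubset hvS) (fun e => hw (Finset.mem_of_mem_erase e)) ?_
      exact fun v hv hwv hc => h v (Finset.mem_of_mem_erase hv) hwv
        (crowded_mono (Finset.erase_subset _ _) hc)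
    have hC : reduced G F S + ∑ v ∈ N, reduced G F ((insert w S).erase v) ≤
        (#N + 1) * reduced G (starBound F w N) S := by
      refine (add_le_add_right (Finset.sum_le_sum hB) _).trans ?_
      rw [← reduced_sum, ← reduced_add, ← reduced_const_mul]
      refine reduced_le_reduced fun T h1 h2 => ?_
      refine hF.starBound_superharmonic hN ?_ fun e => hw (h2 e)
      exact fun v hv => h1 (Finset.mem_sdiff.2 ⟨hNS hv, Finset.disjoint_right.1 hdisj hv⟩)
    have hpos : (0 : ℝ) < #(crowded G S) + #N + 1 := by positivity
    refine le_of_mul_le_mul_left ?_ hpos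
    linarith

variable [Fintype V] (G)

/-- The neighbours of a vertex, as a finite set. -/
def nbr (v : V) : Finset V := Finset.univ.filter fun w => G.Adj v w

@[simp] theorem mem_nbr {v w : V} : w ∈ nbr G v ↔ G.Adj v w := by simp [nbr]

/-- The generator of coalescing random walks that cross each edge at rate one. -/
def hopGen (F : Finset V → ℝ) (S : Finset V) : ℝ :=
  ∑ v ∈ S, ∑ w ∈ nbr G v, (F (insert w (S.erase v)) - F S)

end Reduction

section Growth

variable {V : Type*} [DecidableEq V] [Fintype V] {G : SimpleGraph V}

/-- The empty vertices having a particle in their neighbourhood. -/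
def outerBoundary (G : SimpleGraph V) (S : Finset V) : Finset V :=
  Finset.univ.filter fun w => w ∉ S ∧ ∃ u ∈ S, G.Adj u w

theorem mem_outerBoundary {S : Finset V} {w : V} :
    w ∈ outerBoundary G S ↔ w ∉ S ∧ ∃ u ∈ S, G.Adj u w := by simp [outerBoundary]

theorem card_biUnion_nbr_le {Δ : ℕ} (hΔ : ∀ v, #(nbr G v) ≤ Δ) (S : Finset V) :
    #(S.biUnion (nbr G)) ≤ #S * Δ :=
  Finset.card_biUnion_le_card_mul _ _ _ fun v _ => hΔ v

theorem card_outerBoundary_le {Δ : ℕ} (hΔ : ∀ v, #(nbr G v) ≤ Δ) (S : Finset V) :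
    #(outerBoundary G S) ≤ #S * Δ := by
  refine (Finset.card_le_card fun w hw => ?_).trans (card_biUnion_nbr_le hΔ S)
  obtain ⟨-, u, hu, huw⟩ := mem_outerBoundary.1 hw
  exact Finset.mem_biUnion.2 ⟨u, hu, by simpa using huw⟩

theorem card_crowded_insert_le {Δ : ℕ} (hΔ : ∀ v, #(nbr G v) ≤ Δ) {S : Finset V} {w : V}
    (hw : w ∈ outerBoundary G S) : #(crowded G (insert w S)) ≤ #(crowded G S) + Δ + 1 := by
  obtain ⟨-, u, hu, huw⟩ := mem_outerBoundary.1 hw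
  have hN : (S.filter (G.Adj w)).Nonempty := ⟨u, Finset.mem_filter.2 ⟨hu, huw.symm⟩⟩
  have hN' : #(S.filter (G.Adj w)) ≤ Δ :=
    (Finset.card_le_card fun v hv => by simpa using (Finset.mem_filter.1 hv).2).trans (hΔ w)
  rw [crowded_insert hN]
  have h1 := Finset.card_insert_le w (crowded G S ∪ S.filter (G.Adj w))
  have h2 := Finset.card_union_le (crowded G S) (S.filter (G.Adj w))
  omega

theorem card_crowded_erase_lt {S : Finset V} {v : V} (hv : v ∈ crowded G S) :
    #(crowded G (S.erase v)) < #(crowded G S) := by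
  refine Finset.card_lt_card ((Finset.ssubset_iff_of_subset
    (crowded_mono (Finset.erase_subset v S))).2 ⟨v, hv, fun h => ?_⟩)
  exact Finset.notMem_erase v S (crowded_subset _ h)

namespace IsRankLike

variable {F : Finset V → ℝ}

theorem reduced_le_card (hF : IsRankLike F) (S : Finset V) : reduced G F S ≤ #S := by
  rw [← reduced_const (G := G) (#S : ℝ) S]
  exact reduced_le_reduced fun T _ h => (hF.mono _ _ h).trans (hF.le_card S)

theorem reduced_nonneg (hF : IsRankLike F) (S : Finset V) : 0 ≤ reduced G F S := by
  rw [← reduced_const (G := G) 0 S]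
  exact reduced_le_reduced fun T _ _ => hF.nonneg T

theorem reduced_insert_le_add_card (hF : IsRankLike F) (S : Finset V) (w : V) :
    reduced G F (insert w S) - reduced G F S ≤ #(crowded G S) + 1 := by
  have h1 : reduced G F (insert w S) ≤ F (insert w S) := by
    rw [← reduced_const (G := G) (F (insert w S)) (insert w S)]
    exact reduced_le_reduced fun T _ h => hF.mono _ _ h
  have h2 : F (S \ crowded G S) ≤ reduced G F S := by
    rw [← reduced_const (G := G) (F (S \ crowded G S)) S]
    exact reduced_le_reduced fun T h _ => hF.mono _ _ h
  have h3 := hF.insert_le w S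
  have h4 := hF.union_le_add_card (S \ crowded G S) (crowded G S)
  rw [Finset.sdiff_union_of_subset (crowded_subset S)] at h4
  linarith

theorem starBound_le (hF : IsRankLike F) {N T : Finset V} {w : V} (hN : N.Nonempty) (hNT : N ⊆ T)
    (hw : w ∉ T) :
    starBound F w N T ≤ F T + (∑ v ∈ N, (F (insert w (T.erase v)) - F T)) / 2 := by
  have hm : (1 : ℝ) ≤ #N := by exact_mod_cast Finset.card_pos.2 hN
  have h1 : ∑ v ∈ N, (F (insert w (T.erase v)) - F T) =
      #N * (F (insert w T) - F T) - ∑ v ∈ N, (F (insert w T) - F ((insert w T).erase v)) := by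
    rw [← nsmul_eq_mul, ← Finset.sum_const, ← Finset.sum_sub_distrib]
    refine Finset.sum_congr rfl fun v hv => ?_
    rw [Finset.erase_insert_of_ne fun e : w = v => hw (e ▸ hNT hv)]
    ring
  have h2 : 0 ≤ F (insert w T) - F T := sub_nonneg.2 (hF.mono _ _ (Finset.subset_insert w T))
  have h3 : (F (insert w T) - F T) / (#N + 1) ≤ #N * (F (insert w T) - F T) / 2 := by
    rw [div_le_div_iff₀ (by positivity) two_pos]
    nlinarith [mul_nonneg h2 (sub_nonneg.2 hm), mul_nonneg (mul_nonneg h2 (sub_nonneg.2 hm))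
      (zero_le_one.trans hm)]
  rw [starBound, h1]
  linarith

/-- The mean growth of the reduced functional when boundary vertices become occupied is at most
half the action of the hopping generator, up to a contribution of crowded particles. -/
theorem sum_reduced_insert_le (hF : IsRankLike F) {Δ : ℕ} (hΔ : ∀ v, #(nbr G v) ≤ Δ)
    (S : Finset V) :
    ∑ w ∈ outerBoundary G S, (reduced G F (insert w S) - reduced G F S) ≤
      Δ * #(crowded G S) * (#(crowded G S) + 1) +
        ((Δ + Δ ^ 2) * #(crowded G S) + reduced G (hopGen G F) S) / 2 := by
  set E := crowded G S with hE
  set bad := (outerBoundary G S).filter fun w => ∃ v ∈ E, G.Adj v w with hbad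
  set good := (outerBoundary G S).filter fun w => ¬ ∃ v ∈ E, G.Adj v w with hgood
  have hbadE : bad ⊆ E.biUnion (nbr G) := by
    intro w hw
    obtain ⟨-, v, hv, hvw⟩ := Finset.mem_filter.1 hw
    exact Finset.mem_biUnion.2 ⟨v, hv, by simpa using hvw⟩
  have hcardE := card_biUnion_nbr_le hΔ E
  have hsumbad : ∑ w ∈ bad, (reduced G F (insert w S) - reduced G F S) ≤
      Δ * #E * (#E + 1) := by
    refine (Finset.sum_le_card_nsmul _ _ _ fun w _ => hF.reduced_insert_le_add_card S w).trans ?_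
    rw [nsmul_eq_mul]
    refine mul_le_mul_of_nonneg_right ?_ (by positivity)
    have := (Finset.card_le_card hbadE).trans hcardE
    rw [mul_comm] at this
    exact_mod_cast this
  have hsumgood : ∑ w ∈ good, (reduced G F (insert w S) - reduced G F S) ≤
      ((Δ + Δ ^ 2) * #E + reduced G (hopGen G F) S) / 2 := by
    have hterm : ∀ w ∈ good, reduced G F (insert w S) - reduced G F S ≤
        reduced G (fun T => (1 / 2) * ∑ v ∈ S.filter (G.Adj w),
          (F (insert w (T.erase v)) - F T)) S := by
      intro w hw
      obtain ⟨hw1, hw2⟩ := Finset.mem_filter.1 hw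
      obtain ⟨hwS, u, hu, huw⟩ := mem_outerBoundary.1 hw1
      push Not at hw2
      have hiso : ∀ v ∈ S, G.Adj w v → v ∉ E := fun v _ hwv hv => hw2 v hv hwv.symm
      refine (sub_le_sub_right (hF.reduced_insert_le hwS hiso) _).trans ?_
      rw [← reduced_sub]
      refine reduced_le_reduced fun T h1 h2 => ?_
      have h := hF.starBound_le (N := S.filter (G.Adj w)) (T := T) (w := w)
        ⟨u, Finset.mem_filter.2 ⟨hu, huw.symm⟩⟩ ?_ fun e => hwS (h2 e)
      · linarith
      · intro v hv
        obtain ⟨hvS, hwv⟩ := Finset.mem_filter.1 hv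
        exact h1 (Finset.mem_sdiff.2 ⟨hvS, hiso v hvS hwv⟩)
    refine (Finset.sum_le_sum hterm).trans ?_
    rw [← reduced_sum]
    have hconst := reduced_const (G := G) (((Δ : ℝ) + Δ ^ 2) * #E) S
    rw [show ((Δ + Δ ^ 2) * #E + reduced G (hopGen G F) S) / 2 = (1 / 2) *
      (((Δ : ℝ) + Δ ^ 2) * #E + reduced G (hopGen G F) S) by ring, ← hconst, ← reduced_add,
      ← reduced_const_mul]
    refine reduced_le_reduced fun T h1 h2 => ?_
    rw [← Finset.mul_sum]
    set h : V × V → ℝ := fun q => F (insert q.2 (T.erase q.1)) - F T with hh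
    set Q := (Finset.univ : Finset (V × V)).filter fun q => q.1 ∈ T ∧ G.Adj q.1 q.2 with hQ
    set P := (Finset.univ : Finset (V × V)).filter fun q => q.2 ∈ good ∧ q.1 ∈ S ∧ G.Adj q.2 q.1
      with hP
    have hsumQ : hopGen G F T = ∑ q ∈ Q, h q := by
      rw [hQ, Finset.sum_filter, Fintype.sum_prod_type, hopGen,
        ← Finset.sum_filter_add_sum_filter_not
        (Finset.univ : Finset V) (· ∈ T)]
      rw [Finset.sum_eq_zero (s := Finset.univ.filter (¬ · ∈ T)), add_zero]
      · refine Finset.sum_congr (by ext; simp) fun v hv => ?_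
        rw [nbr, Finset.sum_filter]
        exact Finset.sum_congr rfl fun w _ => by simp_all
      · intro v hv
        exact Finset.sum_eq_zero fun w _ => by simp_all
    have hsumP : ∑ w ∈ good, ∑ v ∈ S.filter (G.Adj w), (F (insert w (T.erase v)) - F T) =
        ∑ q ∈ P, h q := by
      symm
      rw [hP, Finset.sum_filter, Fintype.sum_prod_type_right,
        ← Finset.sum_filter_add_sum_filter_not (Finset.univ : Finset V) (· ∈ good)]
      rw [Finset.sum_eq_zero (s := Finset.univ.filter (¬ · ∈ good)), add_zero]
      · refine Finset.sum_congr (by ext; simp) fun w hw => ?_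
        rw [← Finset.sum_filter]
        exact Finset.sum_congr (by ext v; simp_all) fun v _ => rfl
      · intro v hv
        exact Finset.sum_eq_zero fun w _ => by simp_all
    have hPQ : P ⊆ Q := by
      intro q hq
      simp only [hP, Finset.mem_filter, Finset.mem_univ, true_and] at hq
      simp only [hQ, Finset.mem_filter, Finset.mem_univ, true_and]
      refine ⟨h1 (Finset.mem_sdiff.2 ⟨hq.2.1, fun e => ?_⟩), hq.2.2.symm⟩
      exact (Finset.mem_filter.1 hq.1).2 ⟨q.1, e, hq.2.2.symm⟩
    have hlow : ∀ q ∈ Q, -1 ≤ h q := by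
      intro q hq
      have hqT := (Finset.mem_filter.1 hq).2.1
      have h3 := hF.le_erase_add_one T q.1
      have h4 := hF.mono _ _ (Finset.subset_insert q.2 (T.erase q.1))
      simp only [hh]
      linarith
    have hcard : #(Q \ P) ≤ #E * Δ + #E * Δ * Δ := by
      have hsub : Q \ P ⊆ (E.biUnion fun v => (nbr G v).image fun w => (v, w)) ∪
          ((E.biUnion (nbr G)).biUnion fun w => (nbr G w).image fun v => (v, w)) := by
        rintro ⟨v, w⟩ hq
        simp only [hP, hQ, hgood, Finset.mem_sdiff, Finset.mem_filter, Finset.mem_univ, true_and,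
          mem_outerBoundary] at hq
        obtain ⟨⟨hvT, hvw⟩, hn⟩ := hq
        have hvS := h2 hvT
        simp only [Finset.mem_union, Finset.mem_biUnion, Finset.mem_image, mem_nbr, Prod.mk.injEq]
        by_cases hwS : w ∈ S
        · exact Or.inl ⟨v, mem_crowded.2 ⟨hvS, w, hwS, hvw.symm⟩, w, hvw, rfl, rfl⟩
        · right
          by_contra hcon
          refine hn ⟨⟨⟨hwS, v, hvS, hvw⟩, ?_⟩, hvS, hvw.symm⟩
          rintro ⟨u, hu, huw⟩
          exact hcon ⟨w, ⟨u, hu, huw⟩, v, hvw.symm, rfl, rfl⟩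
      refine (Finset.card_le_card hsub).trans ((Finset.card_union_le _ _).trans (add_le_add ?_ ?_))
      · exact Finset.card_biUnion_le_card_mul _ _ _ fun v _ =>
          Finset.card_image_le.trans (hΔ v)
      · refine (Finset.card_biUnion_le_card_mul _ _ Δ fun v _ =>
          Finset.card_image_le.trans (hΔ v)).trans ?_
        exact Nat.mul_le_mul_right _ hcardE
    have hdiff : -((#E * Δ + #E * Δ * Δ : ℕ) : ℝ) ≤ ∑ q ∈ Q \ P, h q := by
      have h5 := Finset.card_nsmul_le_sum (Q \ P) h (-1) fun q hq =>
        hlow q (Finset.mem_sdiff.1 hq).1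
      rw [nsmul_eq_mul] at h5
      have : ((#(Q \ P) : ℕ) : ℝ) ≤ ((#E * Δ + #E * Δ * Δ : ℕ) : ℝ) := by exact_mod_cast hcard
      linarith
    have hsplit := Finset.sum_sdiff (f := h) hPQ
    rw [hsumP, hsumQ]
    push_cast at hdiff
    linarith
  have := Finset.sum_filter_add_sum_filter_not (outerBoundary G S)
    (fun w => ∃ v ∈ E, G.Adj v w) fun w => reduced G F (insert w S) - reduced G F S
  rw [← this]
  exact add_le_add hsumbad hsumgood

end IsRankLike

end Growth

section Drift

variable {V : Type*} [DecidableEq V] [Fintype V] {G : SimpleGraph V}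

/-- The Lyapunov function: the reduced functional with a penalty for crowded particles. -/
def lyapunov (G : SimpleGraph V) (F : Finset V → ℝ) (p κ κ' : ℝ) (S : Finset V) : ℝ :=
  1 + reduced G F S + p * (κ * (#(crowded G S) : ℝ) ^ 2 + κ' * #(crowded G S))

theorem sum_lyapunov_erase_le (F : Finset V → ℝ) {p κ κ' : ℝ} (hp : 0 ≤ p) (hκ : 0 ≤ κ)
    (hκ' : 0 ≤ κ') (S : Finset V) :
    ∑ v ∈ crowded G S, (lyapunov G F p κ κ' (S.erase v) - lyapunov G F p κ κ' S) ≤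
      -(p * (κ * (#(crowded G S) : ℝ) ^ 2 + κ' * #(crowded G S))) := by
  have hterm : ∀ v ∈ crowded G S, lyapunov G F p κ κ' (S.erase v) - lyapunov G F p κ κ' S ≤
      reduced G F (S.erase v) - reduced G F S - p * (κ * #(crowded G S) + κ') := by
    intro v hv
    have h1 : (#(crowded G (S.erase v)) : ℝ) + 1 ≤ #(crowded G S) := by
      exact_mod_cast card_crowded_erase_lt hv
    have h0 : (0 : ℝ) ≤ #(crowded G (S.erase v)) := by positivity
    set e := (#(crowded G (S.erase v)) : ℝ)
    set E := (#(crowded G S) : ℝ)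
    have h2 : κ * e ^ 2 + κ' * e ≤ κ * E ^ 2 + κ' * E - (κ * E + κ') := by
      have : e ^ 2 ≤ E ^ 2 - E := by nlinarith
      nlinarith [mul_le_mul_of_nonneg_left this hκ, mul_le_mul_of_nonneg_left h1 hκ']
    have h3 := mul_le_mul_of_nonneg_left h2 hp
    simp only [lyapunov]
    linarith
  refine (Finset.sum_le_sum hterm).trans (le_of_eq ?_)
  rw [Finset.sum_sub_distrib, Finset.sum_sub_distrib, sum_reduced_erase]
  simp only [Finset.sum_const, nsmul_eq_mul]
  ring

theorem sum_lyapunov_insert_le {F : Finset V → ℝ} (hF : IsRankLike F) {p κ κ' : ℝ} (hp : 0 ≤ p)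
    (hκ : 0 ≤ κ) (hκ' : 0 ≤ κ') {Δ : ℕ} (hΔ : ∀ v, #(nbr G v) ≤ Δ) (S : Finset V) :
    ∑ w ∈ outerBoundary G S, (lyapunov G F p κ κ' (insert w S) - lyapunov G F p κ κ' S) ≤
      Δ * #(crowded G S) * (#(crowded G S) + 1) +
        ((Δ + Δ ^ 2) * #(crowded G S) + reduced G (hopGen G F) S) / 2 +
        #S * Δ * (p * ((Δ + 1) * (κ * (2 * #(crowded G S) + Δ + 1) + κ'))) := by
  have hterm : ∀ w ∈ outerBoundary G S,
      lyapunov G F p κ κ' (insert w S) - lyapunov G F p κ κ' S ≤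
      (reduced G F (insert w S) - reduced G F S) +
        p * ((Δ + 1) * (κ * (2 * #(crowded G S) + Δ + 1) + κ')) := by
    intro w hw
    have h1 : (#(crowded G (insert w S)) : ℝ) ≤ #(crowded G S) + Δ + 1 := by
      exact_mod_cast card_crowded_insert_le hΔ hw
    have h0 : (0 : ℝ) ≤ #(crowded G (insert w S)) := by positivity
    have h0' : (0 : ℝ) ≤ #(crowded G S) := by positivity
    set e := (#(crowded G (insert w S)) : ℝ)
    set E := (#(crowded G S) : ℝ)
    have h2 : κ * e ^ 2 + κ' * e ≤ κ * E ^ 2 + κ' * E +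
        (Δ + 1) * (κ * (2 * E + Δ + 1) + κ') := by
      have : e ^ 2 ≤ (E + Δ + 1) ^ 2 := by gcongr
      nlinarith [mul_le_mul_of_nonneg_left this hκ, mul_le_mul_of_nonneg_left h1 hκ']
    have h3 := mul_le_mul_of_nonneg_left h2 hp
    simp only [lyapunov]
    linarith
  refine (Finset.sum_le_sum hterm).trans ?_
  rw [Finset.sum_add_distrib, Finset.sum_const, nsmul_eq_mul]
  refine add_le_add (hF.sum_reduced_insert_le hΔ S) ?_
  refine mul_le_mul_of_nonneg_right ?_ (by positivity)
  exact_mod_cast card_outerBoundary_le hΔ S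

theorem lyapunov_drift_le {F : Finset V → ℝ} (hF : IsRankLike F) {p β c k₁ κ κ' b : ℝ} {Δ : ℕ}
    (hΔ : ∀ v, #(nbr G v) ≤ Δ) (hp : 0 ≤ p) (hp2 : p ≤ 1 / 2) (hβ : 0 ≤ β) (hβ1 : β ≤ 1)
    (hgen : ∀ T, hopGen G F T ≤ -β * (#T - k₁)) (hc : 0 ≤ c) (hκ : κ = 2 * Δ)
    (hκ' : κ' = 3 * Δ + Δ ^ 2 + 1 + 8 * c * Δ ^ 2 * (Δ + 1))
    (hb : b = Δ * (Δ + 1) * (κ * (Δ + 1) + κ')) (S : Finset V) (hpS : p * #S ≤ c) :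
    (1 - p) * ∑ v ∈ crowded G S, (lyapunov G F p κ κ' (S.erase v) - lyapunov G F p κ κ' S) +
      p * ∑ w ∈ outerBoundary G S, (lyapunov G F p κ κ' (insert w S) - lyapunov G F p κ κ' S) ≤
      p * (-(β / 2) * (#S - k₁) + p * b * #S) := by
  have hκ0 : 0 ≤ κ := by rw [hκ]; positivity
  have hκ0' : 0 ≤ κ' := by rw [hκ']; positivity
  have h1 := sum_lyapunov_erase_le (G := G) F hp hκ0 hκ0' S
  have h2 := sum_lyapunov_insert_le hF hp hκ0 hκ0' hΔ S
  have hred : reduced G (hopGen G F) S ≤ -β * (#S - #(crowded G S) - k₁) := by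
    rw [← reduced_const (G := G) (-β * (#S - #(crowded G S) - k₁)) S]
    refine reduced_le_reduced fun T hT _ => (hgen T).trans ?_
    have h3 : (#S : ℝ) - #(crowded G S) ≤ #T := by
      rw [← Nat.cast_sub (Finset.card_le_card (crowded_subset S)),
        ← Finset.card_sdiff_of_subset (crowded_subset S)]
      exact_mod_cast Finset.card_le_card hT
    nlinarith
  have hE : (0 : ℝ) ≤ #(crowded G S) := by positivity
  set E := (#(crowded G S) : ℝ)
  set s := (#S : ℝ)
  have h4 : (1 - p) * ∑ v ∈ crowded G S,
      (lyapunov G F p κ κ' (S.erase v) - lyapunov G F p κ κ' S) ≤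
      p * (-(1 / 2) * (κ * E ^ 2 + κ' * E)) := by
    have h5 : 0 ≤ p * (κ * E ^ 2 + κ' * E) := by positivity
    have h6 := mul_le_mul_of_nonneg_left h1 (show 0 ≤ 1 - p by linarith)
    nlinarith [mul_nonneg h5 (show 0 ≤ 1 / 2 - p by linarith)]
  have h7 : s * Δ * (p * ((Δ + 1) * (κ * (2 * E + Δ + 1) + κ'))) ≤
      4 * c * Δ ^ 2 * (Δ + 1) * E + p * b * s := by
    have h8 : (p * s) * (Δ * (Δ + 1) * κ * 2 * E) ≤ c * (Δ * (Δ + 1) * κ * 2 * E) :=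
      mul_le_mul_of_nonneg_right hpS (by positivity)
    rw [hb]
    rw [hκ] at h8 ⊢
    linarith
  have h9 := mul_le_mul_of_nonneg_left h2 hp
  have h10 : Δ * E * (E + 1) + ((Δ + Δ ^ 2) * E + reduced G (hopGen G F) S) / 2 +
      s * Δ * (p * ((Δ + 1) * (κ * (2 * E + Δ + 1) + κ'))) ≤
      (1 / 2) * (κ * E ^ 2 + κ' * E) + (-(β / 2) * (s - k₁) + p * b * s) := by
    have h11 : β * E ≤ E := mul_le_of_le_one_left hE hβ1
    rw [hκ] at h7 ⊢
    rw [hκ'] at h7 ⊢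
    linarith
  have h12 := mul_le_mul_of_nonneg_left h10 hp
  linarith

theorem lyapunov_le {F : Finset V → ℝ} (hF : IsRankLike F) {p κ κ' c : ℝ} (hp : 0 ≤ p)
    (hp1 : p ≤ 1) (hκ : 0 ≤ κ) (hκ' : 0 ≤ κ') (S : Finset V) (hpS : p * #S ≤ c) :
    lyapunov G F p κ κ' S ≤ 1 + (1 + c * κ + κ') * #S := by
  have h1 := hF.reduced_le_card (G := G) S
  have hE : (#(crowded G S) : ℝ) ≤ #S := by
    exact_mod_cast Finset.card_le_card (crowded_subset S)
  have h0 : (0 : ℝ) ≤ #(crowded G S) := by positivity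
  rw [lyapunov]
  set E := (#(crowded G S) : ℝ)
  set s := (#S : ℝ)
  have h2 : E ^ 2 ≤ s * s := by nlinarith
  have h3 : p * (κ * E ^ 2) ≤ c * κ * s :=
    calc p * (κ * E ^ 2) ≤ p * (κ * (s * s)) := by gcongr
      _ = (p * s) * (κ * s) := by ring
      _ ≤ c * (κ * s) := mul_le_mul_of_nonneg_right hpS (mul_nonneg hκ (h0.trans hE))
      _ = _ := by ring
  have h4 : p * (κ' * E) ≤ κ' * s :=
    calc p * (κ' * E) ≤ 1 * (κ' * s) := by gcongr
      _ = _ := one_mul _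
  linarith

theorem one_le_lyapunov {F : Finset V → ℝ} (hF : IsRankLike F) {p κ κ' : ℝ} (hp : 0 ≤ p)
    (hκ : 0 ≤ κ) (hκ' : 0 ≤ κ') (S : Finset V) : 1 ≤ lyapunov G F p κ κ' S := by
  have h1 := hF.reduced_nonneg (G := G) S
  have : 0 ≤ p * (κ * (#(crowded G S) : ℝ) ^ 2 + κ' * #(crowded G S)) := by positivity
  rw [lyapunov]
  linarith

/-- The set of particles of a configuration. -/
def particles (x : V → Bool) : Finset V := Finset.univ.filter fun v => x v = true

theorem mem_particles {x : V → Bool} {v : V} : v ∈ particles x ↔ x v = true := by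
  simp [particles]

theorem particles_update_true (x : V → Bool) (v : V) :
    particles (Function.update x v true) = insert v (particles x) := by
  ext w
  by_cases h : w = v <;> simp [mem_particles, h]

theorem particles_update_false (x : V → Bool) (v : V) :
    particles (Function.update x v false) = (particles x).erase v := by
  ext w
  by_cases h : w = v <;> simp [mem_particles, h]

theorem sum_kcipKernel_mul (p : ℝ) (x : V → Bool) (f : (V → Bool) → ℝ) :
    ∑ y, kcipKernel G p x y * f y = (Fintype.card V : ℝ)⁻¹ * ∑ v,
      if ∃ u, G.Adj u v ∧ x u = true then
        p * f (Function.update x v true) + (1 - p) * f (Function.update x v false)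
      else f x := by
  simp only [kcipKernel, mul_assoc, ← Finset.mul_sum]
  congr 1
  simp only [Finset.sum_mul]
  rw [Finset.sum_comm]
  refine Finset.sum_congr rfl fun v _ => ?_
  have key : ∀ h : Bool → ℝ, ∑ y : V → Bool, (if ∀ w, w ≠ v → y w = x w then h (y v) else 0) * f y =
      ∑ b : Bool, h b * f (Function.update x v b) := by
    intro h
    simp only [ite_mul, zero_mul]
    rw [← Finset.sum_filter]
    symm
    refine Finset.sum_bij (fun b _ => Function.update x v b) ?_ ?_ ?_ ?_
    · intro b _
      simp +contextual
    · intro b _ b' _ hb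
      simpa using congrFun hb v
    · intro y hy
      refine ⟨y v, Finset.mem_univ _, ?_⟩
      rw [Finset.mem_filter] at hy
      ext w
      by_cases hw : w = v
      · subst hw; simp
      · simp [hw, hy.2 w hw]
    · intro b _
      simp
  refine Eq.trans (Finset.sum_congr rfl fun y _ => ?_) ((key fun b =>
    if ∃ u, G.Adj u v ∧ x u = true then (if b = true then p else 1 - p)
      else (if b = x v then 1 else 0)).trans ?_)
  · congr
  rw [Fintype.sum_bool]
  have hself := Function.update_eq_self v x
  by_cases h1 : ∃ u, G.Adj u v ∧ x u = true
  · simp only [if_pos h1]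
    simp
  · simp only [if_neg h1]
    cases hxv : x v <;> rw [hxv] at hself <;> simp [hself]

theorem kcipKernel_nonneg {p : ℝ} (hp : 0 ≤ p) (hp1 : p ≤ 1) (x y : V → Bool) :
    0 ≤ kcipKernel G p x y := by
  refine mul_nonneg (by positivity) (Finset.sum_nonneg fun v _ => ?_)
  split_ifs <;> positivity

/-- The kernel acts on functions of the particle set through removals of crowded particles and
insertions at the outer boundary. -/
theorem sum_kcipKernel_particles [Nonempty V] (p : ℝ) (x : V → Bool) (f : Finset V → ℝ) :
    ∑ y, kcipKernel G p x y * f (particles y) = f (particles x) + (Fintype.card V : ℝ)⁻¹ *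
      ((1 - p) * ∑ v ∈ crowded G (particles x), (f ((particles x).erase v) - f (particles x)) +
        p * ∑ w ∈ outerBoundary G (particles x),
          (f (insert w (particles x)) - f (particles x))) := by
  have hn : (Fintype.card V : ℝ) ≠ 0 := by simp
  rw [sum_kcipKernel_mul p x fun y => f (particles y)]
  have h1 : f (particles x) = (Fintype.card V : ℝ)⁻¹ * ∑ _v : V, f (particles x) := by
    rw [Finset.sum_const, nsmul_eq_mul, Finset.card_univ, inv_mul_cancel_left₀ hn]
  conv_rhs => enter [1]; rw [h1]
  rw [← mul_add]
  congr 1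
  rw [← sub_eq_iff_eq_add', ← Finset.sum_sub_distrib, crowded, outerBoundary,
    show (particles x).filter (fun v => ∃ u ∈ particles x, G.Adj u v) =
      Finset.univ.filter fun v => v ∈ particles x ∧ ∃ u ∈ particles x, G.Adj u v by ext; simp,
    Finset.sum_filter, Finset.sum_filter, Finset.mul_sum, Finset.mul_sum, ← Finset.sum_add_distrib]
  refine Finset.sum_congr rfl fun v _ => ?_
  rw [particles_update_false, particles_update_true]
  by_cases hv : v ∈ particles x
  · rw [Finset.insert_eq_of_mem hv]
    by_cases hu : ∃ u, G.Adj u v ∧ x u = true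
    · have huS : ∃ u ∈ particles x, G.Adj u v := hu.imp fun u h => ⟨mem_particles.2 h.2, h.1⟩
      simp [hv, hu, huS]
      ring
    · have huS : ¬ ∃ u ∈ particles x, G.Adj u v := fun h =>
        hu (h.imp fun u h => ⟨h.2, mem_particles.1 h.1⟩)
      simp [hu, huS]
  · rw [Finset.erase_eq_of_notMem hv]
    by_cases hu : ∃ u, G.Adj u v ∧ x u = true
    · have huS : ∃ u ∈ particles x, G.Adj u v := hu.imp fun u h => ⟨mem_particles.2 h.2, h.1⟩
      simp [hv, hu, huS]
      ring
    · have huS : ¬ ∃ u ∈ particles x, G.Adj u v := fun h =>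
        hu (h.imp fun u h => ⟨h.2, mem_particles.1 h.1⟩)
      simp [hu, huS]

/-- A functional whose hopping drift is negative on large sets yields a Lyapunov function for the
constrained Ising process. -/
theorem exists_kcip_lyapunov (Δ : ℕ) {c : ℝ} (hc : 0 < c) :
    ∃ B : ℝ, 0 < B ∧ ∀ k₁ : ℕ, ∃ k₀ : ℕ, 1 ≤ k₀ ∧ ∃ a b C : ℝ, 0 < a ∧ 0 ≤ b ∧ 0 ≤ C ∧ ∃ N : ℕ,
      ∀ (V : Type) [DecidableEq V] [Fintype V] (G : SimpleGraph V), N < Fintype.card V →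
      (∀ v, #(nbr G v) ≤ Δ) →
      (∃ F, IsRankLike F ∧ ∀ T, hopGen G F T ≤ -(B / Fintype.card V) * (#T - k₁)) →
      0 ≤ c / (Fintype.card V : ℝ) ∧ c / (Fintype.card V : ℝ) ≤ 1 ∧
      ∃ W : (V → Bool) → ℝ, (∀ x, 1 ≤ W x) ∧ (∀ x, W x ≤ C * Fintype.card V) ∧
        (∀ x, ¬ numParticles x ≤ k₀ → ∑ y, kcipKernel G (c / Fintype.card V) x y * W y ≤
          Real.exp (-(a / (Fintype.card V : ℝ) ^ 3)) * W x) ∧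
        (∀ x, numParticles x ≤ k₀ → ∑ y, kcipKernel G (c / Fintype.card V) x y * W y ≤
          Real.exp (b / (Fintype.card V : ℝ) ^ 3) * W x) := by
  obtain ⟨κ, hκ⟩ : ∃ κ : ℝ, κ = 2 * Δ := ⟨_, rfl⟩
  obtain ⟨κ', hκ'⟩ : ∃ κ' : ℝ, κ' = 3 * Δ + Δ ^ 2 + 1 + 8 * c * Δ ^ 2 * (Δ + 1) := ⟨_, rfl⟩
  obtain ⟨b, hb⟩ : ∃ b : ℝ, b = Δ * (Δ + 1) * (κ * (Δ + 1) + κ') := ⟨_, rfl⟩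
  have hκ0 : 0 ≤ κ := by rw [hκ]; positivity
  have hκ0' : 0 ≤ κ' := by rw [hκ']; positivity
  have hb0 : 0 ≤ b := by rw [hb]; positivity
  refine ⟨4 * c * b + 4, by positivity, fun k₁ => ⟨2 * k₁ + 1, by omega, ?_⟩⟩
  obtain ⟨B, hB⟩ : ∃ B, B = 4 * c * b + 4 := ⟨_, rfl⟩
  have hB0 : 0 < B := by rw [hB]; positivity
  rw [← hB]
  obtain ⟨C, hC⟩ : ∃ C, C = 2 + c * κ + κ' := ⟨_, rfl⟩
  have hC0 : 0 < C := by rw [hC]; positivity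
  refine ⟨c / C, c * (B * k₁ / 2 + c * b * (2 * k₁ + 1)), C, by positivity, by positivity,
    hC0.le, ⌈B⌉₊ + ⌈2 * c⌉₊, ?_⟩
  intro V _ _ G hN hΔ ⟨F, hF, hgen⟩
  set n : ℝ := (Fintype.card V : ℝ) with hn
  have hnB : B ≤ n := (Nat.le_ceil B).trans (by rw [hn]; exact_mod_cast (by omega))
  have hnc : 2 * c ≤ n := (Nat.le_ceil (2 * c)).trans (by rw [hn]; exact_mod_cast (by omega))
  have hn0 : 0 < n := hB0.trans_le hnB
  have hn1 : 1 ≤ n := by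
    have : 1 ≤ Fintype.card V := by omega
    rw [hn]; exact_mod_cast this
  have : Nonempty V := Fintype.card_pos_iff.1 (by omega)
  have hp : 0 ≤ c / n := by positivity
  have hp2 : c / n ≤ 1 / 2 := by rw [div_le_div_iff₀ hn0 two_pos]; linarith
  have hβ1 : B / n ≤ 1 := (div_le_one hn0).2 hnB
  have hcard : ∀ S : Finset V, (#S : ℝ) ≤ n := fun S => by
    rw [hn]; exact_mod_cast Finset.card_le_univ S
  have hpS : ∀ S : Finset V, c / n * #S ≤ c := fun S => by
    rw [div_mul_eq_mul_div, div_le_iff₀ hn0]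
    exact mul_le_mul_of_nonneg_left (hcard S) hc.le
  refine ⟨hp, by linarith, fun x => lyapunov G F (c / n) κ κ' (particles x),
    fun x => one_le_lyapunov hF hp hκ0 hκ0' _, fun x => ?_, fun x hx => ?_, fun x hx => ?_⟩
  · refine (lyapunov_le hF hp (by linarith) hκ0 hκ0' _ (hpS _)).trans ?_
    have := mul_le_mul_of_nonneg_left (hcard (particles x))
      (show 0 ≤ 1 + c * κ + κ' by positivity)
    rw [hC]
    linarith
  all_goals
    rw [sum_kcipKernel_particles (c / n) x]
    have hdrift := lyapunov_drift_le hF hΔ hp hp2 (by positivity) hβ1 hgen hc.le hκ hκ' hb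
      (particles x) (hpS _)
    have hW := one_le_lyapunov (G := G) hF hp hκ0 hκ0' (particles x)
    have hle := lyapunov_le (G := G) hF hp (by linarith) hκ0 hκ0' (particles x) (hpS _)
    have hnum : numParticles x = #(particles x) := rfl
    rw [hnum] at hx
    set s := (#(particles x) : ℝ) with hs
    set w := lyapunov G F (c / n) κ κ' (particles x)
    refine le_trans (add_le_add_right (mul_le_mul_of_nonneg_left hdrift
      (inv_nonneg.2 hn0.le)) _) ?_
  · have hs1 : 2 * (k₁ : ℝ) + 2 ≤ s := by rw [hs]; exact_mod_cast (by omega)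
    have hk : (0 : ℝ) ≤ k₁ := by positivity
    have hwC : w ≤ C * s := by rw [hC]; linarith
    have h1 : -(B / n / 2) * (s - k₁) + c / n * b * s ≤ -(1 / n) * s := by
      have h2 : (B / n) * (s / 2) ≤ (B / n) * (s - k₁) :=
        mul_le_mul_of_nonneg_left (by linarith) (by positivity)
      have h3 : B / n = 4 * (c / n * b) + 4 * (1 / n) := by rw [hB]; ring
      rw [h3] at h2 ⊢
      linarith
    have h4 : n⁻¹ * (c / n * (-(B / n / 2) * (s - k₁) + c / n * b * s)) ≤
        -(c / C / n ^ 3) * w :=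
      calc _ ≤ n⁻¹ * (c / n * (-(1 / n) * s)) := by gcongr
        _ = -(c / C / n ^ 3) * (C * s) := by field_simp
        _ ≤ _ := mul_le_mul_of_nonpos_left hwC (by
          have : 0 ≤ c / C / n ^ 3 := by positivity
          linarith)
    calc _ ≤ (-(c / C / n ^ 3) + 1) * w := by linarith
      _ ≤ _ := mul_le_mul_of_nonneg_right (Real.add_one_le_exp _) (by linarith)
  · have hs1 : s ≤ 2 * (k₁ : ℝ) + 1 := by rw [hs]; exact_mod_cast hx
    have hs0 : 0 ≤ s := by positivity
    have h1 : -(B / n / 2) * (s - k₁) + c / n * b * s ≤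
        (1 / n) * (B * k₁ / 2 + c * b * (2 * k₁ + 1)) := by
      have h2 : (c / n * b) * s ≤ (c / n * b) * (2 * k₁ + 1) :=
        mul_le_mul_of_nonneg_left hs1 (by positivity)
      have h3 : 0 ≤ (B / n / 2) * s := by positivity
      have h4 : (1 / n) * (B * k₁ / 2 + c * b * (2 * k₁ + 1)) =
        (B / n / 2) * k₁ + (c / n * b) * (2 * k₁ + 1) := by ring
      linarith
    set b' := c * (B * k₁ / 2 + c * b * (2 * k₁ + 1)) with hb'
    have hb0' : 0 ≤ b' / n ^ 3 := by positivity
    have h4 : n⁻¹ * (c / n * (-(B / n / 2) * (s - k₁) + c / n * b * s)) ≤ b' / n ^ 3 :=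
      calc _ ≤ n⁻¹ * (c / n * ((1 / n) * (B * k₁ / 2 + c * b * (2 * k₁ + 1)))) := by gcongr
        _ = _ := by rw [hb']; field_simp
    have h5 : b' / n ^ 3 ≤ b' / n ^ 3 * w := le_mul_of_one_le_right hb0' hW
    calc _ ≤ (b' / n ^ 3 + 1) * w := by linarith
      _ ≤ _ := mul_le_mul_of_nonneg_right (Real.add_one_le_exp _) (by linarith)

end Drift

section Hopping

variable {V : Type*} [DecidableEq V]

namespace IsRankLike

theorem comp_image {F : Finset V → ℝ} (hF : IsRankLike F) (h : V → V) :
    IsRankLike fun S => F (S.image h) where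
  empty := by simpa using hF.empty
  mono S T hST := hF.mono _ _ (Finset.image_subset_image hST)
  submod S T := by
    have h1 := hF.submod (S.image h) (T.image h)
    have h2 := hF.mono _ _ (Finset.image_inter_subset h S T)
    rw [Finset.image_union]
    linarith
  insert_le v S := by simpa using hF.insert_le (h v) (S.image h)

/-- Subconvex combinations of rank-like functions are rank-like. -/
theorem mix {ι : Type*} {s : Finset ι} {F₀ : Finset V → ℝ} {F : ι → Finset V → ℝ} {α ε : ℝ}
    (hF₀ : IsRankLike F₀) (hF : ∀ i ∈ s, IsRankLike (F i)) (hα : 0 ≤ α) (hε : 0 ≤ ε)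
    (h : α + ε * #s ≤ 1) : IsRankLike fun S => α * F₀ S + ε * ∑ i ∈ s, F i S where
  empty := by
    rw [hF₀.empty, Finset.sum_eq_zero fun i hi => (hF i hi).empty]
    simp
  mono S T hST := add_le_add (mul_le_mul_of_nonneg_left (hF₀.mono _ _ hST) hα)
    (mul_le_mul_of_nonneg_left (Finset.sum_le_sum fun i hi => (hF i hi).mono _ _ hST) hε)
  submod S T := by
    have h1 := mul_le_mul_of_nonneg_left (hF₀.submod S T) hα
    have h2 := mul_le_mul_of_nonneg_left
      (Finset.sum_le_sum fun i hi => (hF i hi).submod S T) hε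
    simp only [Finset.sum_add_distrib] at h2
    linarith
  insert_le v S := by
    have h1 := mul_le_mul_of_nonneg_left (hF₀.insert_le v S) hα
    have h2 := mul_le_mul_of_nonneg_left
      (Finset.sum_le_sum fun i hi => (hF i hi).insert_le v S) hε
    simp only [Finset.sum_add_distrib, Finset.sum_const, nsmul_eq_mul, mul_one] at h2
    linarith

theorem card : IsRankLike fun S : Finset V => (#S : ℝ) where
  empty := by simp
  mono S T hST := by exact_mod_cast Finset.card_le_card hST
  submod S T := by exact_mod_cast (Finset.card_union_add_card_inter S T).le
  insert_le v S := by exact_mod_cast Finset.card_insert_le v S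

end IsRankLike

variable [Fintype V] {G : SimpleGraph V}

/-- The ordered pairs of adjacent vertices. -/
def hopPairs (G : SimpleGraph V) : Finset (V × V) := Finset.univ.filter fun q => G.Adj q.1 q.2

theorem sum_hopPairs {M : Type*} [AddCommMonoid M] (f : V → V → M) :
    ∑ q ∈ hopPairs G, f q.1 q.2 = ∑ v, ∑ w ∈ nbr G v, f v w := by
  simp only [hopPairs, nbr, Finset.sum_filter, Fintype.sum_prod_type]

theorem card_hopPairs_le {Δ : ℕ} (hΔ : ∀ v, #(nbr G v) ≤ Δ) :
    (#(hopPairs G) : ℝ) ≤ Δ * Fintype.card V := by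
  have h := sum_hopPairs (G := G) fun _ _ => 1
  simp only [← Finset.card_eq_sum_ones] at h
  have h2 := Finset.sum_le_card_nsmul Finset.univ (fun v => #(nbr G v)) Δ fun v _ => hΔ v
  rw [← h, Finset.card_univ, smul_eq_mul, mul_comm] at h2
  exact_mod_cast h2

theorem image_update_id (S : Finset V) (v w : V) :
    S.image (Function.update id v w) = if v ∈ S then insert w (S.erase v) else S := by
  ext u
  split_ifs with h
  · simp only [Finset.mem_image, Finset.mem_insert, Finset.mem_erase, Function.update_apply, id]
    constructor
    · rintro ⟨x, hx, rfl⟩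
      split_ifs with hxv
      · exact Or.inl rfl
      · exact Or.inr ⟨hxv, hx⟩
    · rintro (rfl | ⟨hu, huS⟩)
      · exact ⟨v, h, by simp⟩
      · exact ⟨u, huS, by simp [hu]⟩
  · simp only [Finset.mem_image, Function.update_apply, id]
    constructor
    · rintro ⟨x, hx, rfl⟩
      rwa [if_neg fun e : x = v => h (e ▸ hx)]
    · exact fun hu => ⟨u, hu, by rw [if_neg fun e : u = v => h (e ▸ hu)]⟩

theorem hopGen_eq_sum_hopPairs (F : Finset V → ℝ) (S : Finset V) :
    hopGen G F S = ∑ q ∈ hopPairs G, (F (S.image (Function.update id q.1 q.2)) - F S) := by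
  rw [sum_hopPairs fun v w => F (S.image (Function.update id v w)) - F S, hopGen,
    ← Finset.sum_subset (Finset.subset_univ S)]
  · exact Finset.sum_congr rfl fun v hv => by simp [image_update_id, hv]
  · intro v _ hv
    simp [image_update_id, hv]

/-- One step of length `ε` of the hopping dynamics, as an operator on set functions. -/
def hopOp (G : SimpleGraph V) (ε : ℝ) : Module.End ℝ (Finset V → ℝ) where
  toFun F S := F S + ε * hopGen G F S
  map_add' F F' := by
    ext S
    have : hopGen G (F + F') S = hopGen G F S + hopGen G F' S := by
      simp only [hopGen, Pi.add_apply, add_sub_add_comm, Finset.sum_add_distrib]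
    simp only [Pi.add_apply, this]
    ring
  map_smul' c F := by
    ext S
    have : hopGen G (c • F) S = c * hopGen G F S := by
      simp only [hopGen, Pi.smul_apply, smul_eq_mul, ← mul_sub, Finset.mul_sum]
    simp only [Pi.smul_apply, smul_eq_mul, RingHom.id_apply, this]
    ring

theorem hopOp_apply (ε : ℝ) (F : Finset V → ℝ) (S : Finset V) :
    hopOp G ε F S = F S + ε * hopGen G F S := rfl

theorem hopOp_apply_eq_mix (ε : ℝ) (F : Finset V → ℝ) (S : Finset V) :
    hopOp G ε F S = (1 - ε * #(hopPairs G)) * F S +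
      ε * ∑ q ∈ hopPairs G, F (S.image (Function.update id q.1 q.2)) := by
  rw [hopOp_apply, hopGen_eq_sum_hopPairs, Finset.sum_sub_distrib, Finset.sum_const, nsmul_eq_mul]
  ring

variable {ε : ℝ}

theorem hopOp_mono (hε : 0 ≤ ε) (hε1 : ε * #(hopPairs G) ≤ 1) {F F' : Finset V → ℝ}
    (h : F ≤ F') : hopOp G ε F ≤ hopOp G ε F' := by
  intro S
  rw [hopOp_apply_eq_mix, hopOp_apply_eq_mix]
  exact add_le_add (mul_le_mul_of_nonneg_left (h S) (by linarith))
    (mul_le_mul_of_nonneg_left (Finset.sum_le_sum fun q _ => h _) hε)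

theorem hopOp_pow_mono (hε : 0 ≤ ε) (hε1 : ε * #(hopPairs G) ≤ 1) (m : ℕ) {F F' : Finset V → ℝ}
    (h : F ≤ F') : (hopOp G ε ^ m) F ≤ (hopOp G ε ^ m) F' := by
  induction m with
  | zero => simpa using h
  | succ m ih =>
    rw [pow_succ']
    exact hopOp_mono hε hε1 ih

theorem hopOp_pow_const (m : ℕ) (c : ℝ) : (hopOp G ε ^ m) (fun _ => c) = fun _ => c := by
  induction m with
  | zero => simp
  | succ m ih =>
    rw [pow_succ, Module.End.mul_apply, show hopOp G ε (fun _ => c) = fun _ => c from ?_, ih]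
    ext S
    simp [hopOp_apply, hopGen]

theorem IsRankLike.hopOp_pow (hε : 0 ≤ ε) (hε1 : ε * #(hopPairs G) ≤ 1) (m : ℕ)
    {F : Finset V → ℝ} (hF : IsRankLike F) : IsRankLike ((hopOp G ε ^ m) F) := by
  induction m with
  | zero => simpa using hF
  | succ m ih =>
    rw [pow_succ', Module.End.mul_apply]
    have h := IsRankLike.mix (s := hopPairs G) ih
      (fun q _ => ih.comp_image (Function.update id q.1 q.2)) (sub_nonneg.2 hε1) hε (by simp)
    convert h using 2 with S
    exact hopOp_apply_eq_mix ε _ S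

/-- Telescoping the evolution in time. -/
theorem sum_hopOp_pow_hopGen (F : Finset V → ℝ) (S : Finset V) {a b : ℕ} (hab : a ≤ b) :
    ε * ∑ m ∈ Finset.Ico a b, (hopOp G ε ^ m) (hopGen G F) S =
      (hopOp G ε ^ b) F S - (hopOp G ε ^ a) F S := by
  have h : ∀ m, ε * (hopOp G ε ^ m) (hopGen G F) S =
      (hopOp G ε ^ (m + 1)) F S - (hopOp G ε ^ m) F S := by
    intro m
    rw [pow_succ, Module.End.mul_apply, show hopOp G ε F = F + ε • hopGen G F from ?_, map_add,
      map_smul]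
    · simp
    · ext S
      simp [hopOp_apply]
  rw [Finset.mul_sum, Finset.sum_congr rfl fun m _ => h m,
    Finset.sum_Ico_sub (fun m => (hopOp G ε ^ m) F S) hab]

theorem hopGen_mul_sum {κ : Type*} (s : Finset κ) (c : ℝ) (F : κ → Finset V → ℝ) (S : Finset V) :
    hopGen G (fun S => c * ∑ i ∈ s, F i S) S = c * ∑ i ∈ s, hopGen G (F i) S := by
  simp only [hopGen, ← mul_sub, ← Finset.sum_sub_distrib, ← Finset.mul_sum]
  congr 1
  rw [Finset.sum_comm]
  refine Finset.sum_congr rfl fun v _ => ?_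
  rw [Finset.sum_comm]

variable {ι : Type*} [Fintype ι] [DecidableEq ι]

/-- The injective tuples of points of `S`. -/
def injTuples (ι : Type*) [Fintype ι] [DecidableEq ι] (S : Finset V) : Finset (ι → V) :=
  Finset.univ.filter fun a => Function.Injective a ∧ ∀ i, a i ∈ S

/-- The sum of `f` over the tuples of distinct points of a set. -/
def tupleSum (f : (ι → V) → ℝ) (S : Finset V) : ℝ := ∑ a ∈ injTuples ι S, f a

/-- One step of length `ε` of independent random walks. -/
def walkOp (G : SimpleGraph V) (ι : Type*) [Fintype ι] [DecidableEq ι] (ε : ℝ) :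
    Module.End ℝ ((ι → V) → ℝ) where
  toFun f a := f a + ε * ∑ i, ∑ w ∈ nbr G (a i), (f (Function.update a i w) - f a)
  map_add' f f' := by
    ext a
    simp only [Pi.add_apply, add_sub_add_comm, Finset.sum_add_distrib]
    ring
  map_smul' c f := by
    ext a
    simp only [Pi.smul_apply, smul_eq_mul, ← mul_sub, ← Finset.mul_sum, RingHom.id_apply]
    ring

theorem walkOp_apply (f : (ι → V) → ℝ) (a : ι → V) :
    walkOp G ι ε f a =
      f a + ε * ∑ i, ∑ w ∈ nbr G (a i), (f (Function.update a i w) - f a) := rfl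

theorem walkOp_nonneg {Δ : ℕ} (hΔ : ∀ v, #(nbr G v) ≤ Δ) (hε : 0 ≤ ε)
    (hεΔ : ε * (Fintype.card ι * Δ) ≤ 1) {f : (ι → V) → ℝ} (hf : 0 ≤ f) :
    0 ≤ walkOp G ι ε f := by
  intro a
  have hfa : 0 ≤ f a := hf a
  have h1 : -(Fintype.card ι * Δ * f a) ≤
      ∑ i, ∑ w ∈ nbr G (a i), (f (Function.update a i w) - f a) := by
    have h2 : ∀ i ∈ (Finset.univ : Finset ι), -(Δ * f a) ≤
        ∑ w ∈ nbr G (a i), (f (Function.update a i w) - f a) := by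
      intro i _
      have h3 : ∀ w ∈ nbr G (a i), -f a ≤ f (Function.update a i w) - f a := fun w _ => by
        have : 0 ≤ f (Function.update a i w) := hf _
        linarith
      refine le_trans ?_ (Finset.card_nsmul_le_sum _ _ _ h3)
      have : (#(nbr G (a i)) : ℝ) ≤ Δ := by exact_mod_cast hΔ (a i)
      rw [nsmul_eq_mul]
      nlinarith
    refine le_trans (le_of_eq ?_) (Finset.card_nsmul_le_sum _ _ _ h2)
    rw [nsmul_eq_mul, Finset.card_univ]
    ring
  have h4 := mul_le_mul_of_nonneg_left h1 hε
  have h5 := mul_le_mul_of_nonneg_right hεΔ hfa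
  simp only [Pi.zero_apply, walkOp_apply]
  linarith

theorem tupleSum_image_le {f : (ι → V) → ℝ} (hf : 0 ≤ f) (h : V → V) (S : Finset V) :
    tupleSum f (S.image h) ≤ tupleSum (fun a => f (h ∘ a)) S := by
  have hex : ∀ b ∈ injTuples ι (S.image h), ∃ a : ι → V, (∀ i, a i ∈ S) ∧ h ∘ a = b := by
    intro b hb
    have hb' := (Finset.mem_filter.1 hb).2.2
    simp only [Finset.mem_image] at hb'
    choose a ha using hb'
    exact ⟨a, fun i => (ha i).1, funext fun i => (ha i).2⟩
  choose! s hs using hex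
  have hinj : Set.InjOn s (injTuples ι (S.image h) : Set (ι → V)) := fun b hb b' hb' e => by
    rw [← (hs b hb).2, ← (hs b' hb').2, e]
  calc tupleSum f (S.image h) = ∑ b ∈ injTuples ι (S.image h), f (h ∘ s b) :=
        Finset.sum_congr rfl fun b hb => by rw [(hs b hb).2]
    _ = ∑ a ∈ (injTuples ι (S.image h)).image s, f (h ∘ a) := by rw [Finset.sum_image hinj]
    _ ≤ _ := by
      refine Finset.sum_le_sum_of_subset_of_nonneg ?_ fun a _ _ => hf _
      intro a ha
      obtain ⟨b, hb, rfl⟩ := Finset.mem_image.1 ha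
      refine Finset.mem_filter.2 ⟨Finset.mem_univ _, ?_, (hs b hb).1⟩
      refine Function.Injective.of_comp (f := h) ?_
      rw [(hs b hb).2]
      exact (Finset.mem_filter.1 hb).2.1

theorem sum_hopPairs_comp_sub (f : (ι → V) → ℝ) {a : ι → V} (ha : Function.Injective a) :
    ∑ q ∈ hopPairs G, (f (Function.update id q.1 q.2 ∘ a) - f a) =
      ∑ i, ∑ w ∈ nbr G (a i), (f (Function.update a i w) - f a) := by
  rw [sum_hopPairs fun v w => f (Function.update id v w ∘ a) - f a,
    ← Finset.sum_subset (Finset.subset_univ (Finset.univ.image a)), Finset.sum_image ha.injOn]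
  · refine Finset.sum_congr rfl fun i _ => Finset.sum_congr rfl fun w _ => ?_
    congr 2
    ext j
    by_cases hj : j = i
    · subst hj; simp
    · simp [hj, ha.eq_iff]
  · intro v _ hv
    refine Finset.sum_eq_zero fun w _ => ?_
    rw [sub_eq_zero]
    congr 1
    ext j
    have : a j ≠ v := fun e => hv (Finset.mem_image.2 ⟨j, Finset.mem_univ _, e⟩)
    simp [this]

/-- Coalescing walks are dominated by independent walks. -/
theorem hopOp_tupleSum_le (hε : 0 ≤ ε) {f : (ι → V) → ℝ} (hf : 0 ≤ f) :
    hopOp G ε (tupleSum f) ≤ tupleSum (walkOp G ι ε f) := by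
  intro S
  rw [hopOp_apply, hopGen_eq_sum_hopPairs]
  have h1 : ∑ q ∈ hopPairs G, (tupleSum f (S.image (Function.update id q.1 q.2)) - tupleSum f S) ≤
      ∑ q ∈ hopPairs G, ∑ a ∈ injTuples ι S, (f (Function.update id q.1 q.2 ∘ a) - f a) := by
    refine Finset.sum_le_sum fun q _ => ?_
    rw [Finset.sum_sub_distrib]
    exact sub_le_sub_right (tupleSum_image_le hf _ S) _
  refine (add_le_add_right (mul_le_mul_of_nonneg_left h1 hε) _).trans (le_of_eq ?_)
  rw [Finset.sum_comm, tupleSum, tupleSum, Finset.mul_sum, ← Finset.sum_add_distrib]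
  refine Finset.sum_congr rfl fun a ha => ?_
  rw [walkOp_apply, sum_hopPairs_comp_sub f (Finset.mem_filter.1 ha).2.1]

theorem hopOp_pow_tupleSum_le {Δ : ℕ} (hΔ : ∀ v, #(nbr G v) ≤ Δ) (hε : 0 ≤ ε)
    (hε1 : ε * #(hopPairs G) ≤ 1) (hεΔ : ε * (Fintype.card ι * Δ) ≤ 1) (m : ℕ)
    {f : (ι → V) → ℝ} (hf : 0 ≤ f) :
    (hopOp G ε ^ m) (tupleSum f) ≤ tupleSum ((walkOp G ι ε ^ m) f) := by
  induction m generalizing f with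
  | zero => simp
  | succ m ih =>
    rw [pow_succ, pow_succ]
    exact (hopOp_pow_mono hε hε1 m (hopOp_tupleSum_le hε hf)).trans
      (ih (walkOp_nonneg hΔ hε hεΔ hf))

theorem tupleSum_le_of_le {f : (ι → V) → ℝ} {c : ℝ} (hc : 0 ≤ c) (h : ∀ a, f a ≤ c)
    (S : Finset V) : tupleSum f S ≤ (#S : ℝ) ^ Fintype.card ι * c := by
  refine (Finset.sum_le_card_nsmul _ _ c fun a _ => h a).trans ?_
  rw [nsmul_eq_mul]
  refine mul_le_mul_of_nonneg_right ?_ hc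
  have h1 : #(injTuples ι S) ≤ #(Fintype.piFinset fun _ : ι => S) :=
    Finset.card_le_card fun a ha => Fintype.mem_piFinset.2 (Finset.mem_filter.1 ha).2.2
  rw [Fintype.card_piFinset, Finset.prod_const, Finset.card_univ] at h1
  exact_mod_cast h1

end Hopping

section PairEnergy

variable {V : Type*} [DecidableEq V] [Fintype V] {G : SimpleGraph V}

theorem sum_fin_succ_arrow {n : ℕ} (f : (Fin (n + 1) → V) → ℝ) :
    ∑ a, f a = ∑ v, ∑ b : Fin n → V, f (Fin.cons v b) := by
  rw [← (Fin.consEquiv fun _ : Fin (n + 1) => V).sum_comp, Fintype.sum_prod_type]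
  rfl

/-- The sum of a kernel over the ordered pairs of distinct points of a set. -/
def pairSum (f : V → V → ℝ) (S : Finset V) : ℝ := ∑ v ∈ S, ∑ w ∈ S.erase v, f v w

/-- The sum of a kernel over the ordered triples of distinct points of a set. -/
def tripleSum (f : V → V → V → ℝ) (S : Finset V) : ℝ :=
  ∑ v ∈ S, ∑ w ∈ S.erase v, ∑ l ∈ (S.erase v).erase w, f v w l

theorem pairSum_eq_tupleSum (f : V → V → ℝ) :
    pairSum f = tupleSum fun a : Fin 2 → V => f (a 0) (a 1) := by
  ext S
  rw [tupleSum, injTuples, Finset.sum_filter, sum_fin_succ_arrow, pairSum,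
    ← Finset.sum_subset (Finset.subset_univ S)]
  · refine Finset.sum_congr rfl fun v hv => ?_
    rw [sum_fin_succ_arrow, ← Finset.sum_subset (Finset.subset_univ (S.erase v))]
    · refine Finset.sum_congr rfl fun w hw => ?_
      have := Finset.ne_of_mem_erase hw
      have := Finset.mem_of_mem_erase hw
      simp [Fin.forall_fin_two, Function.Injective, *]
      grind
    · intro w _ hw
      simp [Fin.forall_fin_two, Function.Injective]
      grind
  · intro v _ hv
    refine Finset.sum_eq_zero fun b _ => ?_
    rw [if_neg]
    exact fun h => hv (h.2 0)

theorem tripleSum_eq_tupleSum (f : V → V → V → ℝ) :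
    tripleSum f = tupleSum fun a : Fin 3 → V => f (a 0) (a 1) (a 2) := by
  ext S
  rw [tupleSum, injTuples, Finset.sum_filter, sum_fin_succ_arrow, tripleSum,
    ← Finset.sum_subset (Finset.subset_univ S)]
  · refine Finset.sum_congr rfl fun v hv => ?_
    rw [sum_fin_succ_arrow, ← Finset.sum_subset (Finset.subset_univ (S.erase v))]
    · refine Finset.sum_congr rfl fun w hw => ?_
      rw [sum_fin_succ_arrow, ← Finset.sum_subset
        (Finset.subset_univ ((S.erase v).erase w))]
      · refine Finset.sum_congr rfl fun l hl => ?_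
        have : Function.Injective (Fin.cons v (Fin.cons w (Fin.cons l default)) : Fin 3 → V) ∧
          ∀ i, (Fin.cons v (Fin.cons w (Fin.cons l default)) : Fin 3 → V) i ∈ S := by
          simp [Fin.forall_fin_succ, Function.Injective]
          grind
        rw [Fintype.sum_unique, if_pos this]
        rfl
      · intro l _ hl
        rw [Fintype.sum_unique, if_neg]
        simp [Fin.forall_fin_succ, Function.Injective]
        grind
    · intro w _ hw
      refine Finset.sum_eq_zero fun b _ => ?_
      rw [if_neg]
      intro h
      refine hw (Finset.mem_erase.2 ⟨fun e => ?_, h.2 1⟩)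
      have : (1 : Fin 3) = 0 := h.1 (by simpa using e)
      exact absurd this (by decide)
  · intro v _ hv
    refine Finset.sum_eq_zero fun b _ => ?_
    rw [if_neg]
    exact fun h => hv (h.2 0)

theorem pairSum_insert {g : V → V → ℝ} (hg : ∀ a b, g a b = g b a) {A : Finset V} {w : V}
    (hw : w ∉ A) : pairSum g (insert w A) = pairSum g A + 2 * ∑ l ∈ A, g w l := by
  rw [pairSum, Finset.sum_insert hw, Finset.erase_insert hw]
  have h : ∀ v ∈ A, ∑ l ∈ (insert w A).erase v, g v l = g w v + ∑ l ∈ A.erase v, g v l := by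
    intro v hv
    rw [Finset.erase_insert_of_ne fun e : w = v => hw (e ▸ hv),
      Finset.sum_insert fun e => hw (Finset.mem_of_mem_erase e), hg v w]
  rw [Finset.sum_congr rfl h, Finset.sum_add_distrib, pairSum]
  ring

/-- The number of ordered pairs of adjacent points of a set. -/
def adjPairs (G : SimpleGraph V) : Finset V → ℝ := pairSum fun v w => if G.Adj v w then 1 else 0

theorem hopGen_card (S : Finset V) :
    hopGen G (fun S => (#S : ℝ)) S = -adjPairs G S := by
  rw [hopGen, adjPairs, pairSum, ← Finset.sum_neg_distrib]
  refine Finset.sum_congr rfl fun v hv => ?_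
  have h : ∀ w, ((#(insert w (S.erase v)) : ℕ) : ℝ) - #S = if w ∈ S.erase v then -1 else 0 := by
    intro w
    have h1 : ((#(S.erase v) : ℕ) : ℝ) + 1 = #S := by
      exact_mod_cast Finset.card_erase_add_one hv
    split_ifs with hw
    · rw [Finset.insert_eq_of_mem hw]; linarith
    · rw [Finset.card_insert_of_notMem hw]; push_cast; linarith
  simp only [h]
  rw [← Finset.sum_neg_distrib, nbr, Finset.sum_filter,
    ← Finset.sum_subset (Finset.subset_univ (S.erase v))]
  · refine Finset.sum_congr rfl fun w hw => ?_
    simp only [hw, if_true]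
    split_ifs <;> simp
  · intro w _ hw
    simp [hw]

theorem hopGen_pairSum_ge {g : V → V → ℝ} (hg : ∀ a b, g a b = g b a) {ν Γ : ℝ}
    (hlap : ∀ a b, a ≠ b → ∑ w ∈ nbr G a, (g w b - g a b) = ν) (hΓ : ∀ a, g a a ≤ Γ)
    (S : Finset V) :
    2 * ν * ((#S : ℝ) ^ 2 - #S) - 2 * Γ * adjPairs G S -
      2 * tripleSum (fun v w l => if G.Adj v w then |g w l| else 0) S ≤
      hopGen G (pairSum g) S := by
  have hv : ∀ v ∈ S, 2 * ν * (#S - 1) -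
      2 * ∑ w ∈ S.erase v, (if G.Adj v w then
        Γ + ∑ l ∈ (S.erase v).erase w, |g w l| else 0) ≤
      ∑ w ∈ nbr G v, (pairSum g (insert w (S.erase v)) - pairSum g S) := by
    intro v hv
    set A := S.erase v with hA
    have hvA : v ∉ A := Finset.notMem_erase v S
    have hcard : (#A : ℝ) = #S - 1 := by
      rw [← Finset.card_erase_add_one hv]; push_cast; ring
    have hterm : ∀ w ∈ nbr G v, 2 * ∑ l ∈ A, (g w l - g v l) -
        (if w ∈ A then 2 * (Γ + ∑ l ∈ A.erase w, |g w l|) else 0) ≤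
        pairSum g (insert w A) - pairSum g S := by
      intro w _
      have hS : pairSum g S = pairSum g A + 2 * ∑ l ∈ A, g v l := by
        rw [← pairSum_insert hg hvA, hA, Finset.insert_erase hv]
      rw [hS, Finset.sum_sub_distrib]
      split_ifs with hw
      · rw [Finset.insert_eq_of_mem hw, ← Finset.add_sum_erase A (fun l => g w l) hw]
        have h1 : ∑ l ∈ A.erase w, g w l ≤ ∑ l ∈ A.erase w, |g w l| :=
          Finset.sum_le_sum fun l _ => le_abs_self _
        linarith [hΓ w]
      · rw [pairSum_insert hg hw]
        linarith
    refine le_trans (le_of_eq ?_) (Finset.sum_le_sum hterm)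
    rw [Finset.sum_sub_distrib, ← Finset.mul_sum, Finset.sum_comm,
      Finset.sum_congr rfl fun l hl => hlap v l fun e => hvA (e ▸ hl), Finset.sum_const,
      nsmul_eq_mul, hcard, nbr, Finset.sum_filter, Finset.mul_sum]
    congr 1
    · ring
    · rw [← Finset.sum_subset (Finset.subset_univ A)]
      · refine Finset.sum_congr rfl fun w hw => ?_
        simp only [hw, if_true]
        split_ifs <;> ring
      · intro w _ hw
        simp [hw]
  refine le_trans (le_of_eq ?_) (Finset.sum_le_sum hv)
  rw [Finset.sum_sub_distrib, Finset.sum_const, nsmul_eq_mul, ← Finset.mul_sum, adjPairs, pairSum,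
    tripleSum]
  have : ∀ v ∈ S, ∑ w ∈ S.erase v, (if G.Adj v w then
        Γ + ∑ l ∈ (S.erase v).erase w, |g w l| else 0) =
      Γ * ∑ w ∈ S.erase v, (if G.Adj v w then 1 else 0) +
        ∑ w ∈ S.erase v, ∑ l ∈ (S.erase v).erase w, (if G.Adj v w then |g w l| else 0) := by
    intro v _
    rw [Finset.mul_sum, ← Finset.sum_add_distrib]
    refine Finset.sum_congr rfl fun w _ => ?_
    split_ifs <;> simp
  rw [Finset.sum_congr rfl this, Finset.sum_add_distrib, ← Finset.mul_sum]
  ring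

theorem abs_hopOp_pow_pairSum_le {Δ : ℕ} (hΔ : ∀ v, #(nbr G v) ≤ Δ) {g : V → V → ℝ}
    {n K η ε : ℝ} {m : ℕ} (hn : 0 < n) (hη0 : 0 ≤ η) (hη : ∑ a, ∑ b, |g a b| ≤ η * n ^ 2)
    (hker : ∀ f : (Fin 2 → V) → ℝ, 0 ≤ f → ∀ a,
      (walkOp G (Fin 2) ε ^ m) f a ≤ (K / n) ^ 2 * ∑ b, f b)
    (hε : 0 ≤ ε) (hε1 : ε * #(hopPairs G) ≤ 1) (hεΔ : ε * (3 * Δ) ≤ 1) (S : Finset V) :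
    |(hopOp G ε ^ m) (pairSum g) S| ≤ (#S : ℝ) ^ 2 * K ^ 2 * η := by
  have hcardι : ε * (Fintype.card (Fin 2) * Δ) ≤ 1 := by
    simp only [Fintype.card_fin]
    push_cast
    nlinarith [mul_nonneg hε (Nat.cast_nonneg (α := ℝ) Δ)]
  have habs : (hopOp G ε ^ m) (pairSum fun a b => |g a b|) S ≤ (#S : ℝ) ^ 2 * K ^ 2 * η := by
    rw [pairSum_eq_tupleSum]
    have hf : (0 : (Fin 2 → V) → ℝ) ≤ fun a => |g (a 0) (a 1)| := fun a => abs_nonneg _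
    refine (hopOp_pow_tupleSum_le hΔ hε hε1 hcardι m hf S).trans ?_
    refine (tupleSum_le_of_le (c := (K / n) ^ 2 * (η * n ^ 2)) (by positivity)
      (fun a => (hker _ hf a).trans ?_) S).trans (le_of_eq ?_)
    · refine mul_le_mul_of_nonneg_left (le_trans (le_of_eq ?_) hη) (by positivity)
      simp only [sum_fin_succ_arrow, Fintype.sum_unique]
      rfl
    · rw [Fintype.card_fin]
      field_simp
  have hmono : ∀ {F F' : Finset V → ℝ}, F ≤ F' → (hopOp G ε ^ m) F S ≤ (hopOp G ε ^ m) F' S :=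
    fun h => hopOp_pow_mono hε hε1 m h S
  rw [abs_le]
  constructor
  · have h1 : -(pairSum fun a b => |g a b|) ≤ pairSum g := fun T => by
      simp only [Pi.neg_apply, pairSum, ← Finset.sum_neg_distrib]
      exact Finset.sum_le_sum fun v _ => Finset.sum_le_sum fun w _ => neg_abs_le _
    have h2 := hmono h1
    simp only [map_neg, Pi.neg_apply] at h2
    linarith
  · refine (hmono fun T => ?_).trans habs
    exact Finset.sum_le_sum fun v _ => Finset.sum_le_sum fun w _ => le_abs_self _

theorem hopOp_pow_tripleSum_le {Δ : ℕ} (hΔ : ∀ v, #(nbr G v) ≤ Δ) {g : V → V → ℝ}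
    {n K η ε : ℝ} {m : ℕ} (hn : 0 < n) (hη0 : 0 ≤ η) (hK : 0 ≤ K)
    (hη : ∑ a, ∑ b, |g a b| ≤ η * n ^ 2)
    (hker : ∀ f : (Fin 3 → V) → ℝ, 0 ≤ f → ∀ a,
      (walkOp G (Fin 3) ε ^ m) f a ≤ (K / n) ^ 3 * ∑ b, f b)
    (hε : 0 ≤ ε) (hε1 : ε * #(hopPairs G) ≤ 1) (hεΔ : ε * (3 * Δ) ≤ 1) (S : Finset V) :
    (hopOp G ε ^ m) (tripleSum fun v w l => if G.Adj v w then |g w l| else 0) S ≤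
      (#S : ℝ) ^ 3 * K ^ 3 * (Δ * η / n) := by
  rw [tripleSum_eq_tupleSum]
  have hf : (0 : (Fin 3 → V) → ℝ) ≤ fun a => if G.Adj (a 0) (a 1) then |g (a 1) (a 2)| else 0 :=
    fun a => by
      simp only [Pi.zero_apply]
      split_ifs <;> positivity
  refine (hopOp_pow_tupleSum_le hΔ hε hε1 (by simpa using hεΔ) m hf S).trans ?_
  refine (tupleSum_le_of_le (c := (K / n) ^ 3 * (Δ * (η * n ^ 2))) (by positivity)
    (fun a => (hker _ hf a).trans ?_) S).trans (le_of_eq ?_)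
  · refine mul_le_mul_of_nonneg_left ?_ (by positivity)
    have h1 : ∑ b : Fin 3 → V, (if G.Adj (b 0) (b 1) then |g (b 1) (b 2)| else 0) =
        ∑ v, ∑ w, ∑ l, if G.Adj v w then |g w l| else 0 := by
      simp only [sum_fin_succ_arrow, Fintype.sum_unique]
      rfl
    rw [h1, Finset.sum_comm]
    refine le_trans ?_ (mul_le_mul_of_nonneg_left hη (by positivity))
    rw [Finset.mul_sum]
    refine Finset.sum_le_sum fun w _ => ?_
    have h2 : ∀ v, ∑ l, (if G.Adj v w then |g w l| else 0) =
        if G.Adj w v then ∑ l, |g w l| else 0 := fun v => by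
      simp only [G.adj_comm v w]
      split_ifs <;> simp
    simp only [h2]
    rw [← Finset.sum_filter, Finset.sum_const, nsmul_eq_mul]
    refine mul_le_mul_of_nonneg_right ?_ (Finset.sum_nonneg fun _ _ => abs_nonneg _)
    exact_mod_cast hΔ w
  · rw [Fintype.card_fin]
    field_simp

/-- Green kernel data forcing coalescence: after macroscopic time, a bounded number of walkers has
shrunk to a quarter. -/
theorem hopOp_pow_card_le_quarter {Δ : ℕ} (hΔ : ∀ v, #(nbr G v) ≤ Δ) {g : V → V → ℝ}
    (hg : ∀ a b, g a b = g b a) {n τ Γ K η ε : ℝ} {k M : ℕ} (hn : 0 < n) (hτ : 0 < τ)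
    (hΓ0 : 0 ≤ Γ) (hK : 0 ≤ K) (hη0 : 0 ≤ η)
    (hlap : ∀ a b, a ≠ b → ∑ w ∈ nbr G a, (g w b - g a b) = 1 / n) (hΓ : ∀ a, g a a ≤ Γ)
    (hη : ∑ a, ∑ b, |g a b| ≤ η * n ^ 2)
    (hker2 : ∀ f : (Fin 2 → V) → ℝ, 0 ≤ f → ∀ m, M ≤ m → ∀ a,
      (walkOp G (Fin 2) ε ^ m) f a ≤ (K / n) ^ 2 * ∑ b, f b)
    (hker3 : ∀ f : (Fin 3 → V) → ℝ, 0 ≤ f → ∀ m, M ≤ m → ∀ a,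
      (walkOp G (Fin 3) ε ^ m) f a ≤ (K / n) ^ 3 * ∑ b, f b)
    (hε : 0 ≤ ε) (hεM : ε * M = τ * n) (hε1 : ε * #(hopPairs G) ≤ 1) (hεΔ : ε * (3 * Δ) ≤ 1)
    (hk : 16 * (Γ / τ + 2) ≤ k)
    (hkη : ((k : ℝ) ^ 2 * K ^ 2 / τ + (k : ℝ) ^ 3 * K ^ 3 * Δ) * η ≤ 1)
    {S : Finset V} (hS : #S = k) :
    (hopOp G ε ^ (2 * M)) (fun S => (#S : ℝ)) S ≤ k / 4 := by
  set P : ℕ → (Finset V → ℝ) → Finset V → ℝ := fun m F => (hopOp G ε ^ m) F with hP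
  set N : Finset V → ℝ := fun S => (#S : ℝ) with hN
  have hmono : ∀ m {F F' : Finset V → ℝ}, F ≤ F' → P m F S ≤ P m F' S := fun m F F' h =>
    hopOp_pow_mono hε hε1 m h S
  have hconst : ∀ m (c : ℝ), P m (fun _ => c) S = c := fun m c => by
    simp only [hP, hopOp_pow_const]
  set r := P (2 * M) N S with hr
  by_contra! hlt
  have hΓτ : 0 ≤ Γ / τ := by positivity
  have hC0 : 0 ≤ adjPairs G := fun T => Finset.sum_nonneg fun v _ => Finset.sum_nonneg fun w _ => by
    dsimp only
    split_ifs <;> norm_num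
  have hgenN : hopGen G N = -adjPairs G := funext fun T => hopGen_card T
  have htelC : ∀ m, m ≤ 2 * M →
      ε * ∑ j ∈ Finset.Ico m (2 * M), P j (adjPairs G) S = P m N S - r := by
    intro m hm
    have h := sum_hopOp_pow_hopGen (G := G) (ε := ε) N S hm
    rw [hgenN] at h
    simp only [map_neg, Pi.neg_apply, Finset.sum_neg_distrib] at h
    simp only [hr, hP]
    linarith
  have hPC0 : ∀ j, 0 ≤ P j (adjPairs G) S := fun j => by
    rw [← hconst j 0]
    exact hmono j hC0
  have hanti : ∀ m, m ≤ 2 * M → r ≤ P m N S := fun m hm => by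
    have := mul_nonneg hε (Finset.sum_nonneg fun j (_ : j ∈ Finset.Ico m (2 * M)) => hPC0 j)
    linarith [htelC m hm]
  have hPN : ∀ m, m ≤ 2 * M → P m N S ≤ k := by
    intro m _
    have h := (IsRankLike.card.hopOp_pow (G := G) hε hε1 m).le_card S
    rwa [hS] at h
  set N2 : Finset V → ℝ := fun S => (#S : ℝ) ^ 2 - #S with hN2
  have hN2low : ∀ m, m ≤ 2 * M → r ^ 2 - r ≤ P m N2 S := by
    intro m hm
    have h1 : (2 * r - 1) • N - (fun _ => r ^ 2) ≤ N2 := by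
      intro T
      simp only [Pi.sub_apply, Pi.smul_apply, smul_eq_mul, hN, hN2]
      nlinarith [sq_nonneg ((#T : ℝ) - r)]
    have h2 := hmono m h1
    simp only [hP, map_sub, map_smul, Pi.sub_apply, Pi.smul_apply, smul_eq_mul,
      hopOp_pow_const] at h2
    have h3 := hanti m hm
    simp only [hP] at h3 ⊢
    have hr1 : 0 ≤ 2 * r - 1 := by
      linarith
    nlinarith [mul_le_mul_of_nonneg_left h3 hr1]
  set Ψ := tripleSum (fun v w l => if G.Adj v w then |g w l| else 0) with hΨ
  have hpair : ∀ m, M ≤ m → |P m (pairSum g) S| ≤ (k : ℝ) ^ 2 * K ^ 2 * η := fun m hm => by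
    rw [← hS]
    exact abs_hopOp_pow_pairSum_le hΔ hn hη0 hη (fun f hf => hker2 f hf m hm) hε hε1 hεΔ S
  have htriple : ∀ m, M ≤ m → P m Ψ S ≤ (k : ℝ) ^ 3 * K ^ 3 * (Δ * η / n) := fun m hm => by
    rw [← hS]
    exact hopOp_pow_tripleSum_le hΔ hn hη0 hK hη (fun f hf => hker3 f hf m hm) hε hε1 hεΔ S
  have hgen : ∀ m, (2 * (1 / n)) * P m N2 S - 2 * Γ * P m (adjPairs G) S - 2 * P m Ψ S ≤
      P m (hopGen G (pairSum g)) S := by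
    intro m
    have h1 : (2 * (1 / n)) • N2 - (2 * Γ) • adjPairs G - (2 : ℝ) • Ψ ≤ hopGen G (pairSum g) :=
      fun T => hopGen_pairSum_ge hg hlap hΓ T
    have h2 := hmono m h1
    simpa only [hP, map_sub, map_smul, Pi.sub_apply, Pi.smul_apply, smul_eq_mul] using h2
  have htel := sum_hopOp_pow_hopGen (G := G) (ε := ε) (pairSum g) S (show M ≤ 2 * M by omega)
  have hlower : (M : ℝ) * ((2 * (1 / n)) * (r ^ 2 - r) -
      2 * ((k : ℝ) ^ 3 * K ^ 3 * (Δ * η / n))) -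
      2 * Γ * ∑ m ∈ Finset.Ico M (2 * M), P m (adjPairs G) S ≤
      ∑ m ∈ Finset.Ico M (2 * M), P m (hopGen G (pairSum g)) S := by
    have hcardIco : (M : ℝ) = #(Finset.Ico M (2 * M)) := by
      rw [Nat.card_Ico]; congr 1; omega
    rw [hcardIco, ← nsmul_eq_mul, ← Finset.sum_const, Finset.mul_sum, ← Finset.sum_sub_distrib]
    refine Finset.sum_le_sum fun m hm => le_trans ?_ (hgen m)
    rw [Finset.mem_Ico] at hm
    have h1 := mul_le_mul_of_nonneg_left (hN2low m hm.2.le) (show 0 ≤ 2 * (1 / n) by positivity)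
    linarith [htriple m hm.1]
  have h1 := mul_le_mul_of_nonneg_left hlower hε
  have h2 := htelC M (by omega)
  have h3 := hPN M (by omega)
  have h4 := abs_le.1 (hpair (2 * M) (by omega))
  have h5 := abs_le.1 (hpair M le_rfl)
  have hk0 : (0 : ℝ) ≤ k := by positivity
  have hk32 : (32 : ℝ) ≤ k := by linarith
  have h6 : Γ * (ε * ∑ m ∈ Finset.Ico M (2 * M), P m (adjPairs G) S) ≤ Γ * k := by
    rw [h2]
    exact mul_le_mul_of_nonneg_left (by linarith) hΓ0
  have h7 : ε * ((M : ℝ) * ((2 * (1 / n)) * (r ^ 2 - r) -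
      2 * ((k : ℝ) ^ 3 * K ^ 3 * (Δ * η / n)))) =
      2 * τ * (r ^ 2 - r - (k : ℝ) ^ 3 * K ^ 3 * Δ * η) := by
    rw [← mul_assoc, hεM]
    field_simp
  have h8 : τ * (r ^ 2 - r) ≤ τ * (Γ / τ * k + 1) := by
    have h9 : τ * (((k : ℝ) ^ 2 * K ^ 2 / τ + (k : ℝ) ^ 3 * K ^ 3 * Δ) * η) ≤ τ * 1 :=
      mul_le_mul_of_nonneg_left hkη hτ.le
    have h10 : τ * (((k : ℝ) ^ 2 * K ^ 2 / τ + (k : ℝ) ^ 3 * K ^ 3 * Δ) * η) =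
      (k : ℝ) ^ 2 * K ^ 2 * η + τ * ((k : ℝ) ^ 3 * K ^ 3 * Δ * η) := by field_simp
    have h11 : τ * (Γ / τ * k + 1) = Γ * k + τ := by field_simp
    rw [h11]
    simp only [hP] at h1 h4 h5 h6
    linarith
  have h12 := le_of_mul_le_mul_left h8 hτ
  have h13 : (k : ℝ) * (16 * (Γ / τ + 2)) ≤ k * k := mul_le_mul_of_nonneg_left hk hk0
  nlinarith

end PairEnergy

section Contraction

variable {V : Type*} [DecidableEq V]

/-- A bound on the sets of one size spreads to all sets by subadditivity. -/
theorem IsRankLike.le_quarter_add {F : Finset V → ℝ} (hF : IsRankLike F) {k : ℕ} (hk : 1 ≤ k)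
    (h : ∀ S, #S = k → F S ≤ k / 4) (S : Finset V) : F S ≤ (#S : ℝ) / 4 + k := by
  induction hs : #S using Nat.strong_induction_on generalizing S with
  | _ s ih =>
    rcases Nat.lt_or_ge s k with hsk | hsk
    · have h1 := hF.le_card S
      rw [hs] at h1
      have h2 : (s : ℝ) ≤ k := by exact_mod_cast hsk.le
      have h3 : (0 : ℝ) ≤ s := by positivity
      linarith
    · obtain ⟨A, hA, hAk⟩ := Finset.exists_subset_card_eq (hs ▸ hsk)
      have h1 := hF.union_le (S \ A) A
      rw [Finset.sdiff_union_of_subset hA] at h1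
      have hcard : #(S \ A) = s - k := by rw [Finset.card_sdiff_of_subset hA, hs, hAk]
      have h2 := ih (s - k) (by omega) (S \ A) hcard
      rw [Nat.cast_sub hsk] at h2
      linarith [h A hAk]

/-- Averaging the hopping evolution of the cardinality turns contraction into a drift. -/
theorem exists_isRankLike_drift [Fintype V] {G : SimpleGraph V} {ε τ n : ℝ} {k M : ℕ}
    (hn : 0 < n) (hτ : 0 < τ) (hM : 1 ≤ M) (hk : 1 ≤ k) (hε : 0 ≤ ε)
    (hε1 : ε * #(hopPairs G) ≤ 1) (hεM : ε * M = τ * n)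
    (h : ∀ S : Finset V, #S = k → (hopOp G ε ^ (2 * M)) (fun S => (#S : ℝ)) S ≤ k / 4) :
    ∃ F : Finset V → ℝ, IsRankLike F ∧
      ∀ T, hopGen G F T ≤ -(3 / (8 * τ) / n) * (#T - (2 * k : ℕ)) := by
  set R : ℕ → Finset V → ℝ := fun m => (hopOp G ε ^ m) fun S => (#S : ℝ) with hR
  have hRr : ∀ m, IsRankLike (R m) := fun m => IsRankLike.card.hopOp_pow hε hε1 m
  have hM0 : (0 : ℝ) < M := by exact_mod_cast hM
  have hε0 : 0 < ε := by
    rcases hε.eq_or_lt with rfl | h0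
    · nlinarith [mul_pos hτ hn]
    · exact h0
  refine ⟨fun S => (2 * M : ℝ)⁻¹ * ∑ m ∈ Finset.range (2 * M), R m S, ?_, fun T => ?_⟩
  · have h1 := IsRankLike.mix (s := Finset.range (2 * M)) (F := R) (α := 0)
      (ε := (2 * M : ℝ)⁻¹) IsRankLike.card (fun m _ => hRr m) le_rfl (by positivity)
      (by rw [Finset.card_range]; push_cast; field_simp; simp)
    simpa using h1
  · rw [hopGen_mul_sum]
    have hstep : ∀ m, ε * hopGen G (R m) T = R (m + 1) T - R m T := fun m => by
      simp only [hR, pow_succ', Module.End.mul_apply, hopOp_apply]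
      ring
    have hsum : ε * ∑ m ∈ Finset.range (2 * M), hopGen G (R m) T = R (2 * M) T - #T := by
      rw [Finset.mul_sum, Finset.sum_congr rfl fun m _ => hstep m,
        Finset.sum_range_sub (fun m => R m T)]
      simp [hR]
    have h1 := (hRr (2 * M)).le_quarter_add hk h T
    have h2 : (2 * M : ℝ)⁻¹ * ∑ m ∈ Finset.range (2 * M), hopGen G (R m) T =
        (2 * (τ * n))⁻¹ * (R (2 * M) T - #T) := by
      rw [← hsum, ← hεM]
      field_simp
    have h3 : -(3 / (8 * τ) / n) * ((#T : ℝ) - (2 * k : ℕ)) =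
        (2 * (τ * n))⁻¹ * (-(3 / 4) * (#T - 2 * k)) := by
      push_cast
      field_simp
      ring
    rw [h2, h3]
    refine mul_le_mul_of_nonneg_left ?_ (by positivity)
    have : (0 : ℝ) ≤ k := by positivity
    linarith

end Contraction

section Cayley

variable {V : Type*} [AddCommGroup V] [DecidableEq V] [Fintype V] {G : SimpleGraph V}
  {N : Finset V}

/-- The eigenvalue of the Laplacian of a Cayley graph at a character. -/
def charGap (N : Finset V) (ψ : AddChar V ℂ) : ℝ := ∑ s ∈ N, (1 - (ψ s).re)

theorem charGap_zero : charGap N 0 = 0 := by simp [charGap]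

theorem abs_char_re_le_one (ψ : AddChar V ℂ) (v : V) : |(ψ v).re| ≤ 1 :=
  (Complex.abs_re_le_norm _).trans (ψ.norm_apply v).le

theorem charGap_nonneg (ψ : AddChar V ℂ) : 0 ≤ charGap N ψ :=
  Finset.sum_nonneg fun s _ => by linarith [(abs_le.1 (abs_char_re_le_one ψ s)).2]

theorem charGap_le (ψ : AddChar V ℂ) : charGap N ψ ≤ 2 * #N := by
  have h := Finset.sum_le_card_nsmul N (fun s => 1 - (ψ s).re) 2 fun s _ => by
    linarith [(abs_le.1 (abs_char_re_le_one ψ s)).1]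
  rw [nsmul_eq_mul] at h
  rw [charGap]
  linarith

theorem sum_nbr_eq (hG : ∀ a w, G.Adj a w ↔ w - a ∈ N) {M : Type*} [AddCommMonoid M] (a : V)
    (f : V → M) : ∑ w ∈ nbr G a, f w = ∑ s ∈ N, f (a + s) := by
  refine Finset.sum_nbij' (fun w => w - a) (fun s => a + s) ?_ ?_ ?_ ?_ ?_ <;>
    simp [hG]

theorem neg_mem_of_cayley (hG : ∀ a w, G.Adj a w ↔ w - a ∈ N) {s : V} (hs : s ∈ N) : -s ∈ N := by
  have h : G.Adj 0 s := (hG _ _).2 (by simpa using hs)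
  simpa using (hG _ _).1 h.symm

theorem sum_char_sub_one (hG : ∀ a w, G.Adj a w ↔ w - a ∈ N) (ψ : AddChar V ℂ) :
    ∑ s ∈ N, (ψ s - 1) = -(charGap N ψ : ℂ) := by
  have him : ∑ s ∈ N, (ψ s).im = ∑ s ∈ N, -(ψ s).im := by
    refine Finset.sum_nbij' (fun s => -s) (fun s => -s) (fun s hs => neg_mem_of_cayley hG hs)
      (fun s hs => neg_mem_of_cayley hG hs) (by simp) (by simp) fun s _ => ?_
    rw [AddChar.map_neg_eq_conj]
    simp
  rw [Finset.sum_neg_distrib] at him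
  apply Complex.ext
  · simp [charGap]
  · simp only [Complex.im_sum, Complex.sub_im, Complex.one_im, sub_zero, Complex.neg_im,
      Complex.ofReal_im]
    linarith

theorem sum_nbr_char (hG : ∀ a w, G.Adj a w ↔ w - a ∈ N) (ψ : AddChar V ℂ) (a b : V) :
    ∑ w ∈ nbr G a, (ψ (w - b) - ψ (a - b)) = -(charGap N ψ : ℂ) * ψ (a - b) := by
  rw [sum_nbr_eq hG a fun w => ψ (w - b) - ψ (a - b), ← sum_char_sub_one hG ψ, Finset.sum_mul]
  refine Finset.sum_congr rfl fun s _ => ?_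
  rw [show a + s - b = s + (a - b) by abel, ψ.map_add_eq_mul]
  ring

/-- The Green kernel of the Laplacian of a Cayley graph on functions of mean zero. -/
def greenKernel (N : Finset V) (a b : V) : ℝ :=
  (Fintype.card V : ℝ)⁻¹ * ∑ ψ ∈ Finset.univ.erase (0 : AddChar V ℂ), (ψ (a - b)).re / charGap N ψ

theorem greenKernel_symm (a b : V) : greenKernel N a b = greenKernel N b a := by
  rw [greenKernel, greenKernel]
  congr 1
  refine Finset.sum_congr rfl fun ψ _ => ?_
  rw [← neg_sub b a, AddChar.map_neg_eq_conj, Complex.conj_re]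

theorem sum_nbr_greenKernel (hG : ∀ a w, G.Adj a w ↔ w - a ∈ N)
    (hgap : ∀ ψ : AddChar V ℂ, ψ ≠ 0 → 0 < charGap N ψ) {a b : V} (hab : a ≠ b) :
    ∑ w ∈ nbr G a, (greenKernel N w b - greenKernel N a b) = 1 / Fintype.card V := by
  simp only [greenKernel, ← mul_sub, ← Finset.sum_sub_distrib, ← Finset.mul_sum]
  rw [Finset.sum_comm, one_div]
  have h : ∀ ψ ∈ Finset.univ.erase (0 : AddChar V ℂ), ∑ w ∈ nbr G a,
      ((ψ (w - b)).re / charGap N ψ - (ψ (a - b)).re / charGap N ψ) = -(ψ (a - b)).re := by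
    intro ψ hψ
    have h1 := congr_arg Complex.re (sum_nbr_char hG ψ a b)
    simp only [Complex.re_sum, Complex.sub_re, ← Complex.ofReal_neg, Complex.re_ofReal_mul] at h1
    have := hgap ψ (Finset.ne_of_mem_erase hψ)
    simp only [← sub_div, ← Finset.sum_div, h1]
    field_simp
  rw [Finset.sum_congr rfl h, Finset.sum_neg_distrib]
  have h2 := congr_arg Complex.re (AddChar.sum_apply_eq_ite (a - b))
  rw [if_neg (sub_ne_zero.2 hab), Complex.re_sum,
    ← Finset.add_sum_erase _ _ (Finset.mem_univ (0 : AddChar V ℂ))] at h2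
  simp only [AddChar.zero_apply, Complex.one_re, Complex.zero_re] at h2
  rw [show -∑ ψ ∈ Finset.univ.erase (0 : AddChar V ℂ), (ψ (a - b)).re = 1 by linarith, mul_one]

theorem greenKernel_self_le {Γ : ℝ}
    (hΓ : ∑ ψ ∈ Finset.univ.erase (0 : AddChar V ℂ), (charGap N ψ)⁻¹ ≤ Γ * Fintype.card V)
    (a : V) : greenKernel N a a ≤ Γ := by
  have hn : (0 : ℝ) < Fintype.card V := by exact_mod_cast Fintype.card_pos
  simp only [greenKernel, sub_self, AddChar.map_zero_eq_one, Complex.one_re, one_div]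
  rw [inv_mul_le_iff₀ hn]
  linarith

theorem sum_norm_sq_char (c : AddChar V ℂ → ℝ) :
    ∑ v, ‖∑ ψ, (c ψ : ℂ) * ψ v‖ ^ 2 = Fintype.card V * ∑ ψ, c ψ ^ 2 := by
  have h : ∀ v, ((‖∑ ψ, (c ψ : ℂ) * ψ v‖ ^ 2 : ℝ) : ℂ) =
      ∑ ψ, ∑ φ, (c ψ * c φ : ℂ) * (ψ - φ) v := by
    intro v
    rw [Complex.ofReal_pow, ← Complex.mul_conj', map_sum, Finset.sum_mul_sum]
    refine Finset.sum_congr rfl fun ψ _ => Finset.sum_congr rfl fun φ _ => ?_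
    rw [map_mul, Complex.conj_ofReal, sub_eq_add_neg, AddChar.add_apply, AddChar.neg_apply,
      AddChar.map_neg_eq_conj]
    ring
  apply Complex.ofReal_injective
  rw [Complex.ofReal_sum, Finset.sum_congr rfl fun v _ => h v, Finset.sum_comm]
  push_cast
  rw [Finset.mul_sum]
  refine Finset.sum_congr rfl fun ψ _ => ?_
  rw [Finset.sum_comm]
  simp only [← Finset.mul_sum, AddChar.sum_eq_ite, sub_eq_zero]
  simp
  ring

theorem sum_abs_greenKernel_le {η : ℝ} (hη0 : 0 ≤ η)
    (hη : ∑ ψ ∈ Finset.univ.erase (0 : AddChar V ℂ), (charGap N ψ)⁻¹ ^ 2 ≤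
      η ^ 2 * (Fintype.card V : ℝ) ^ 2) :
    ∑ a, ∑ b, |greenKernel N a b| ≤ η * (Fintype.card V : ℝ) ^ 2 := by
  set n := (Fintype.card V : ℝ) with hn
  have hn0 : 0 < n := by rw [hn]; exact_mod_cast Fintype.card_pos
  set c : AddChar V ℂ → ℝ := fun ψ => if ψ = 0 then 0 else n⁻¹ * (charGap N ψ)⁻¹ with hc
  have hc2 : ∑ ψ, c ψ ^ 2 ≤ η ^ 2 := by
    rw [← Finset.add_sum_erase _ _ (Finset.mem_univ (0 : AddChar V ℂ))]
    have h1 : ∑ ψ ∈ Finset.univ.erase (0 : AddChar V ℂ), c ψ ^ 2 =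
        (n⁻¹) ^ 2 * ∑ ψ ∈ Finset.univ.erase (0 : AddChar V ℂ), (charGap N ψ)⁻¹ ^ 2 := by
      rw [Finset.mul_sum]
      refine Finset.sum_congr rfl fun ψ hψ => ?_
      simp only [hc, if_neg (Finset.ne_of_mem_erase hψ), mul_pow]
    rw [h1]
    have h2 := mul_le_mul_of_nonneg_left hη (sq_nonneg n⁻¹)
    have h3 : n⁻¹ ^ 2 * (η ^ 2 * n ^ 2) = η ^ 2 := by field_simp
    simp only [hc, if_true]
    linarith
  have hgre : ∀ a b, |greenKernel N a b| ≤ ‖∑ ψ, (c ψ : ℂ) * ψ (a - b)‖ := by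
    intro a b
    refine le_trans (le_of_eq ?_) (Complex.abs_re_le_norm _)
    congr 1
    rw [Complex.re_sum, ← Finset.add_sum_erase _ _ (Finset.mem_univ (0 : AddChar V ℂ)),
      greenKernel, Finset.mul_sum]
    simp only [Complex.re_ofReal_mul]
    rw [show c 0 = 0 by simp [hc], zero_mul, zero_add]
    refine Finset.sum_congr rfl fun ψ hψ => ?_
    simp only [hc, if_neg (Finset.ne_of_mem_erase hψ)]
    ring
  have hrow : ∀ a, ∑ b, |greenKernel N a b| ≤ η * n := by
    intro a
    have h1 : ∑ b, |greenKernel N a b| ≤ ∑ v, ‖∑ ψ, (c ψ : ℂ) * ψ v‖ := by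
      refine (Finset.sum_le_sum fun b _ => hgre a b).trans (le_of_eq ?_)
      exact (Equiv.subLeft a).sum_comp fun v => ‖∑ ψ, (c ψ : ℂ) * ψ v‖
    refine h1.trans (abs_le_of_sq_le_sq' ?_ (by positivity)).2
    refine sq_sum_le_card_mul_sum_sq.trans ?_
    rw [sum_norm_sq_char, Finset.card_univ, ← hn]
    have := mul_le_mul_of_nonneg_left hc2 (sq_nonneg n)
    linarith
  refine (Finset.sum_le_card_nsmul _ _ _ fun a _ => hrow a).trans (le_of_eq ?_)
  rw [Finset.card_univ, nsmul_eq_mul, ← hn]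
  ring

variable {r : ℕ} {ε : ℝ}

theorem walkOp_char (hG : ∀ a w, G.Adj a w ↔ w - a ∈ N) (ψ : Fin r → AddChar V ℂ)
    (b : Fin r → V) :
    walkOp G (Fin r) ε (fun a => (∏ i, ψ i (a i - b i)).re) =
      (1 - ε * ∑ i, charGap N (ψ i)) • fun a => (∏ i, ψ i (a i - b i)).re := by
  ext a
  rw [walkOp_apply, Pi.smul_apply, smul_eq_mul]
  have h : ∀ i, ∑ w ∈ nbr G (a i), ((∏ j, ψ j (Function.update a i w j - b j)).re -
      (∏ j, ψ j (a j - b j)).re) = -charGap N (ψ i) * (∏ j, ψ j (a j - b j)).re := by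
    intro i
    have h1 : ∀ w, ∏ j, ψ j (Function.update a i w j - b j) =
        ψ i (w - b i) * ∏ j ∈ Finset.univ.erase i, ψ j (a j - b j) := by
      intro w
      rw [← Finset.mul_prod_erase _ _ (Finset.mem_univ i), Function.update_self]
      congr 1
      refine Finset.prod_congr rfl fun j hj => ?_
      rw [Function.update_of_ne (Finset.ne_of_mem_erase hj)]
    simp only [h1, ← Finset.mul_prod_erase _ (fun j => ψ j (a j - b j)) (Finset.mem_univ i),
      ← Complex.sub_re, ← sub_mul, ← Complex.re_sum, ← Finset.sum_mul, sum_nbr_char hG]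
    rw [← Complex.ofReal_neg, mul_assoc, Complex.re_ofReal_mul]
  rw [Finset.sum_congr rfl fun i _ => h i, ← Finset.sum_mul, Finset.sum_neg_distrib]
  ring

theorem walkOp_pow_char (hG : ∀ a w, G.Adj a w ↔ w - a ∈ N) (ψ : Fin r → AddChar V ℂ)
    (b : Fin r → V) (m : ℕ) :
    (walkOp G (Fin r) ε ^ m) (fun a => (∏ i, ψ i (a i - b i)).re) =
      (1 - ε * ∑ i, charGap N (ψ i)) ^ m • fun a => (∏ i, ψ i (a i - b i)).re := by
  induction m with
  | zero => simp
  | succ m ih => rw [pow_succ, Module.End.mul_apply, walkOp_char hG, map_smul, ih, smul_smul,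
      mul_comm, ← pow_succ]

theorem eq_sum_char (f : (Fin r → V) → ℝ) :
    f = ∑ b, ∑ ψ : Fin r → AddChar V ℂ, (f b * ((Fintype.card V : ℝ)⁻¹) ^ r) •
      fun a => (∏ i, ψ i (a i - b i)).re := by
  have hn : (Fintype.card V : ℝ) ≠ 0 := by exact_mod_cast Fintype.card_ne_zero
  ext a
  simp only [Finset.sum_apply, Pi.smul_apply, smul_eq_mul, ← Finset.mul_sum]
  have h : ∀ b : Fin r → V, ∑ ψ : Fin r → AddChar V ℂ, (∏ i, ψ i (a i - b i)).re =
      if b = a then (Fintype.card V : ℝ) ^ r else 0 := by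
    intro b
    rw [← Complex.re_sum, ← Fintype.prod_sum fun i (χ : AddChar V ℂ) => χ (a i - b i)]
    simp only [AddChar.sum_apply_eq_ite, sub_eq_zero]
    split_ifs with hb
    · subst hb
      simp [← Complex.ofReal_natCast, ← Complex.ofReal_pow]
    · obtain ⟨i, hi⟩ := Function.ne_iff.1 hb
      rw [Finset.prod_eq_zero (Finset.mem_univ i) (if_neg fun e => hi e.symm), Complex.zero_re]
  simp only [h, mul_ite, mul_zero, Finset.sum_ite_eq', Finset.mem_univ, if_true]
  rw [mul_assoc, ← mul_pow, inv_mul_cancel₀ hn, one_pow, mul_one]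

/-- On-diagonal heat kernel bounds for independent walks on a Cayley graph. -/
theorem walkOp_pow_le (hG : ∀ a w, G.Adj a w ↔ w - a ∈ N) {Γ τ : ℝ} {M : ℕ} (hτ : 0 < τ)
    (hgap : ∀ ψ : AddChar V ℂ, ψ ≠ 0 → 0 < charGap N ψ)
    (hΓ : ∑ ψ ∈ Finset.univ.erase (0 : AddChar V ℂ), (charGap N ψ)⁻¹ ≤ Γ * Fintype.card V)
    (hε : 0 ≤ ε) (hεM : ε * M = τ * Fintype.card V) (hεr : ε * (r * (2 * #N)) ≤ 1)
    {f : (Fin r → V) → ℝ} (hf : 0 ≤ f) {m : ℕ} (hm : M ≤ m) (a : Fin r → V) :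
    (walkOp G (Fin r) ε ^ m) f a ≤ ((1 + Γ / τ) / Fintype.card V) ^ r * ∑ b, f b := by
  set n := (Fintype.card V : ℝ) with hn
  have hn0 : 0 < n := by rw [hn]; exact_mod_cast Fintype.card_pos
  have hexp : ∑ ψ : AddChar V ℂ, Real.exp (-(ε * m) * charGap N ψ) ≤ 1 + Γ / τ := by
    rw [← Finset.add_sum_erase _ _ (Finset.mem_univ (0 : AddChar V ℂ)), charGap_zero, mul_zero,
      Real.exp_zero]
    have h1 : ∀ ψ ∈ Finset.univ.erase (0 : AddChar V ℂ),
        Real.exp (-(ε * m) * charGap N ψ) ≤ (τ * n)⁻¹ * (charGap N ψ)⁻¹ := by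
      intro ψ hψ
      have hg := hgap ψ (Finset.ne_of_mem_erase hψ)
      have h2 : τ * n ≤ ε * m := by
        rw [← hεM]
        exact mul_le_mul_of_nonneg_left (by exact_mod_cast hm) hε
      have h3 : τ * n * charGap N ψ ≤ Real.exp (ε * m * charGap N ψ) := by
        have := Real.add_one_le_exp (ε * m * charGap N ψ)
        have := mul_le_mul_of_nonneg_right h2 hg.le
        linarith
      rw [neg_mul, Real.exp_neg, ← mul_inv]
      exact inv_anti₀ (by positivity) h3
    have h4 := (Finset.sum_le_sum h1)
    rw [← Finset.mul_sum] at h4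
    have h5 := mul_le_mul_of_nonneg_left hΓ (show 0 ≤ (τ * n)⁻¹ by positivity)
    have h6 : (τ * n)⁻¹ * (Γ * n) = Γ / τ := by field_simp
    linarith
  have hker : ∀ b : Fin r → V, ∑ ψ : Fin r → AddChar V ℂ,
      (1 - ε * ∑ i, charGap N (ψ i)) ^ m * (∏ i, ψ i (a i - b i)).re ≤ (1 + Γ / τ) ^ r := by
    intro b
    refine le_trans ?_ (pow_le_pow_left₀ (Finset.sum_nonneg fun _ _ => (Real.exp_pos _).le) hexp r)
    rw [Fintype.sum_pow]
    refine Finset.sum_le_sum fun ψ _ => ?_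
    have h1 : (∏ i, ψ i (a i - b i)).re ≤ 1 := by
      refine (Complex.re_le_norm _).trans (le_of_eq ?_)
      rw [norm_prod]
      exact Finset.prod_eq_one fun i _ => (ψ i).norm_apply _
    have h2 : 0 ≤ 1 - ε * ∑ i, charGap N (ψ i) := by
      have := Finset.sum_le_card_nsmul Finset.univ (fun i => charGap N (ψ i)) (2 * #N)
        fun i _ => charGap_le (ψ i)
      rw [Finset.card_univ, Fintype.card_fin, nsmul_eq_mul] at this
      linarith [mul_le_mul_of_nonneg_left this hε]
    have h3 : (1 - ε * ∑ i, charGap N (ψ i)) ^ m ≤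
        ∏ i, Real.exp (-(ε * m) * charGap N (ψ i)) := by
      rw [← Real.exp_sum]
      refine (pow_le_pow_left₀ h2 (Real.one_sub_le_exp_neg _) m).trans (le_of_eq ?_)
      rw [← Real.exp_nat_mul, ← Finset.mul_sum]
      congr 1
      ring
    exact (mul_le_of_le_one_right (pow_nonneg h2 m) h1).trans h3
  have hexpand : (walkOp G (Fin r) ε ^ m) f a = ∑ b, (f b * n⁻¹ ^ r) *
      ∑ ψ : Fin r → AddChar V ℂ,
        (1 - ε * ∑ i, charGap N (ψ i)) ^ m * (∏ i, ψ i (a i - b i)).re := by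
    conv_lhs => rw [eq_sum_char f]
    simp only [map_sum, map_smul, walkOp_pow_char hG, Finset.sum_apply, Pi.smul_apply,
      smul_eq_mul, Finset.mul_sum, hn]
  rw [hexpand, Finset.mul_sum]
  refine Finset.sum_le_sum fun b _ => ?_
  have h1 := mul_le_mul_of_nonneg_left (hker b)
    (mul_nonneg (hf b) (show 0 ≤ n⁻¹ ^ r by positivity))
  refine h1.trans (le_of_eq ?_)
  rw [div_eq_mul_inv (1 + Γ / τ) n, mul_pow]
  ring

theorem card_nbr_cayley (hG : ∀ a w, G.Adj a w ↔ w - a ∈ N) (a : V) : #(nbr G a) = #N := by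
  have h := sum_nbr_eq hG a fun _ => 1
  simpa using h

/-- A Cayley graph with a transient spectrum carries a rank-like function with a uniform drift under
coalescing walks. -/
theorem exists_isRankLike_drift_cayley (hG : ∀ a w, G.Adj a w ↔ w - a ∈ N) {Γ η τ : ℝ} {k : ℕ}
    (hτ : 0 < τ) (hΓ0 : 0 ≤ Γ) (hη0 : 0 ≤ η)
    (hgap : ∀ ψ : AddChar V ℂ, ψ ≠ 0 → 0 < charGap N ψ)
    (hΓ : ∑ ψ ∈ Finset.univ.erase (0 : AddChar V ℂ), (charGap N ψ)⁻¹ ≤ Γ * Fintype.card V)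
    (hη : ∑ ψ ∈ Finset.univ.erase (0 : AddChar V ℂ), (charGap N ψ)⁻¹ ^ 2 ≤
      η ^ 2 * (Fintype.card V : ℝ) ^ 2)
    (hk : 16 * (Γ / τ + 2) ≤ k)
    (hkη : ((k : ℝ) ^ 2 * (1 + Γ / τ) ^ 2 / τ + (k : ℝ) ^ 3 * (1 + Γ / τ) ^ 3 * #N) * η ≤ 1) :
    ∃ F : Finset V → ℝ, IsRankLike F ∧
      ∀ T, hopGen G F T ≤ -(3 / (8 * τ) / Fintype.card V) * (#T - (2 * k : ℕ)) := by
  have hΔ : ∀ v, #(nbr G v) ≤ #N := fun v => (card_nbr_cayley hG v).le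
  have hhop := card_hopPairs_le hΔ
  set n := (Fintype.card V : ℝ) with hn
  have hn1 : 1 ≤ n := by rw [hn]; exact_mod_cast Fintype.card_pos
  have hn0 : 0 < n := by linarith
  set M := ⌈6 * τ * #N * n ^ 2⌉₊ + 1 with hM
  have hMle : 6 * τ * #N * n ^ 2 ≤ M := by
    rw [hM]; push_cast
    linarith [Nat.le_ceil (6 * τ * #N * n ^ 2)]
  have hM0 : (0 : ℝ) < M := by rw [hM]; positivity
  set ε := τ * n / M with hεdef
  have hε : 0 ≤ ε := by positivity
  have hεM : ε * M = τ * n := by rw [hεdef]; field_simp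
  have hεN : ε * (6 * #N * n) ≤ 1 := by
    rw [hεdef, div_mul_eq_mul_div, div_le_one hM0]
    linarith
  have hεN' : ε * (6 * #N) ≤ 1 := by
    refine le_trans (mul_le_mul_of_nonneg_left ?_ hε) hεN
    exact le_mul_of_one_le_right (by positivity) hn1
  have hεN0 : 0 ≤ ε * #N := by positivity
  have hε1 : ε * #(hopPairs G) ≤ 1 := by
    refine le_trans (mul_le_mul_of_nonneg_left (hhop.trans ?_) hε) hεN
    have : 0 ≤ (#N : ℝ) * n := by positivity
    linarith
  have hΓτ : 0 ≤ Γ / τ := by positivity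
  have hk1 : 1 ≤ k := by
    have : (1 : ℝ) ≤ k := by linarith
    exact_mod_cast this
  refine exists_isRankLike_drift hn0 hτ (by omega) hk1 hε hε1 hεM fun S hS =>
    hopOp_pow_card_le_quarter hΔ (greenKernel_symm (N := N)) hn0 hτ hΓ0 (by linarith) hη0
      (fun a b hab => sum_nbr_greenKernel hG hgap hab) (greenKernel_self_le hΓ)
      (sum_abs_greenKernel_le hη0 hη)
      (fun f hf m hm a => walkOp_pow_le hG hτ hgap hΓ hε hεM ?_ hf hm a)
      (fun f hf m hm a => walkOp_pow_le hG hτ hgap hΓ hε hεM ?_ hf hm a)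
      hε hεM hε1 (by linarith) hk hkη hS
  all_goals
    push_cast
    linarith

end Cayley

section TorusSteps

variable {L d : ℕ}

/-- The steps along the coordinate axes of the torus. -/
def torusSteps (L d : ℕ) : Finset (Fin d → ZMod L) :=
  (Finset.univ.image fun i => Pi.single i 1) ∪ Finset.univ.image fun i => -Pi.single i 1

theorem card_torusSteps_le : #(torusSteps L d) ≤ 2 * d := by
  refine (Finset.card_union_le _ _).trans ?_
  have h1 : #(Finset.univ.image fun i : Fin d => (Pi.single i 1 : Fin d → ZMod L)) ≤ d :=
    Finset.card_image_le.trans (by simp)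
  have h2 : #(Finset.univ.image fun i : Fin d => -(Pi.single i 1 : Fin d → ZMod L)) ≤ d :=
    Finset.card_image_le.trans (by simp)
  omega

theorem torusGraph_adj_iff (hL : 2 ≤ L) (a w : Fin d → ZMod L) :
    (torusGraph L d).Adj a w ↔ w - a ∈ torusSteps L d := by
  have : Fact (1 < L) := ⟨hL⟩
  have hs : ∀ i : Fin d, (fun j => if j = i then (1 : ZMod L) else 0) = Pi.single i 1 := fun i => by
    ext j; simp [Pi.single_apply]
  simp only [torusGraph, SimpleGraph.fromRel_adj, hs, torusSteps, Finset.mem_union,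
    Finset.mem_image, Finset.mem_univ, true_and]
  constructor
  · rintro ⟨-, ⟨i, rfl⟩ | ⟨i, rfl⟩⟩
    · exact Or.inl ⟨i, by simp⟩
    · exact Or.inr ⟨i, by simp⟩
  · rintro (⟨i, hi⟩ | ⟨i, hi⟩)
    · refine ⟨fun e => ?_, Or.inl ⟨i, by rw [hi]; simp⟩⟩
      rw [e, sub_self] at hi
      exact one_ne_zero (α := ZMod L) (by simpa using congr_fun hi i)
    · refine ⟨fun e => ?_, Or.inr ⟨i, by rw [neg_eq_iff_eq_neg.1 hi]; abel⟩⟩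
      rw [e, sub_self, neg_eq_zero] at hi
      exact one_ne_zero (α := ZMod L) (by simpa using congr_fun hi i)

end TorusSteps

/-- The squared length of the minimal representative of a frequency. -/
def freqSq {L d : ℕ} (ξ : Fin d → ZMod L) : ℝ := ∑ i, ((ξ i).valMinAbs : ℝ) ^ 2

theorem one_le_freqSq {L d : ℕ} {ξ : Fin d → ZMod L} (hξ : ξ ≠ 0) : 1 ≤ freqSq ξ := by
  obtain ⟨i, hi⟩ := Function.ne_iff.1 hξ
  refine le_trans ?_ (Finset.single_le_sum (fun j _ => sq_nonneg _) (Finset.mem_univ i))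
  have h : 1 ≤ |(ξ i).valMinAbs| :=
    Int.one_le_abs fun e => hi ((ZMod.valMinAbs_eq_zero _).1 e)
  rw [← sq_abs]
  have h' : (1 : ℝ) ≤ |((ξ i).valMinAbs : ℝ)| := by exact_mod_cast h
  nlinarith

section Torus

variable {L : ℕ} [NeZero L]

theorem card_natAbs_valMinAbs_le (m : ℕ) :
    #(Finset.univ.filter fun z : ZMod L => z.valMinAbs.natAbs ≤ m) ≤ 2 * m + 1 := by
  have h : #(Finset.univ.filter fun z : ZMod L => z.valMinAbs.natAbs ≤ m) ≤
      #(Finset.Icc (-m : ℤ) m) :=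
    Finset.card_le_card_of_injOn ZMod.valMinAbs
      (fun z hz => by
        simp only [Finset.coe_filter, Finset.mem_univ, true_and, Set.mem_ofPred_eq] at hz
        simp only [Finset.coe_Icc, Set.mem_Icc]
        omega)
      (ZMod.injective_valMinAbs.injOn)
  rw [Int.card_Icc] at h
  omega

/-- The frequencies with a prescribed coordinate that is maximal in absolute value. -/
def freqBox {d : ℕ} (i : Fin d) (z : ZMod L) : Finset (Fin d → ZMod L) :=
  Fintype.piFinset fun j =>
    if j = i then {z}
    else Finset.univ.filter fun y : ZMod L => y.valMinAbs.natAbs ≤ z.valMinAbs.natAbs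

theorem card_freqBox_le {d : ℕ} (i : Fin d) (z : ZMod L) :
    #(freqBox i z) ≤ (2 * z.valMinAbs.natAbs + 1) ^ (d - 1) := by
  rw [freqBox, Fintype.card_piFinset, ← Finset.mul_prod_erase _ _ (Finset.mem_univ i)]
  simp only [if_true, Finset.card_singleton, one_mul]
  refine (Finset.prod_le_pow_card _ _ (2 * z.valMinAbs.natAbs + 1) fun j hj => ?_).trans
    (le_of_eq ?_)
  · rw [if_neg (Finset.ne_of_mem_erase hj)]
    exact card_natAbs_valMinAbs_le _
  · rw [Finset.card_erase_of_mem (Finset.mem_univ i), Finset.card_univ, Fintype.card_fin]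

theorem inv_freqSq_le {d : ℕ} {ξ : Fin d → ZMod L} (hξ : ξ ≠ 0) :
    (freqSq ξ)⁻¹ ≤ ∑ i, ∑ z ∈ Finset.univ.erase (0 : ZMod L),
      if ξ ∈ freqBox i z then ((z.valMinAbs : ℝ) ^ 2)⁻¹ else 0 := by
  obtain ⟨i₀, hi₀⟩ := Function.ne_iff.1 hξ
  obtain ⟨i, -, hi⟩ := Finset.exists_max_image Finset.univ (fun j => (ξ j).valMinAbs.natAbs)
    ⟨i₀, Finset.mem_univ _⟩
  have hξi : ξ i ≠ 0 := by
    intro e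
    have h := hi i₀ (Finset.mem_univ _)
    rw [e, ZMod.valMinAbs_zero, Int.natAbs_zero, Nat.le_zero, Int.natAbs_eq_zero,
      ZMod.valMinAbs_eq_zero] at h
    exact hi₀ h
  have hbox : ξ ∈ freqBox i (ξ i) := by
    refine Fintype.mem_piFinset.2 fun j => ?_
    split_ifs with hj
    · simp [hj]
    · simpa using hi j (Finset.mem_univ _)
  have hnn : ∀ j z, 0 ≤ if ξ ∈ freqBox j z then ((z.valMinAbs : ℝ) ^ 2)⁻¹ else 0 := fun j z => by
    split_ifs <;> positivity
  refine le_trans ?_ (Finset.single_le_sum (fun j _ => Finset.sum_nonneg fun z _ => hnn j z)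
    (Finset.mem_univ i))
  refine le_trans ?_ (Finset.single_le_sum (fun z _ => hnn i z)
    (Finset.mem_erase.2 ⟨hξi, Finset.mem_univ (ξ i)⟩))
  rw [if_pos hbox]
  have hne : ((ξ i).valMinAbs : ℝ) ≠ 0 := by
    exact_mod_cast fun e => hξi ((ZMod.valMinAbs_eq_zero _).1 e)
  refine inv_anti₀ (by positivity) ?_
  exact Finset.single_le_sum (f := fun j => ((ξ j).valMinAbs : ℝ) ^ 2) (fun j _ => sq_nonneg _)
    (Finset.mem_univ i)

/-- The lattice sum of `|ξ|⁻²` in dimension at least three. -/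
theorem sum_inv_freqSq_le {d : ℕ} (hd : 3 ≤ d) :
    ∑ ξ ∈ Finset.univ.erase (0 : Fin d → ZMod L), (freqSq ξ)⁻¹ ≤
      d * 3 ^ (d - 1) * (L : ℝ) ^ (d - 2) := by
  obtain ⟨e, rfl⟩ := Nat.exists_eq_add_of_le' hd
  have hz : ∀ i : Fin (e + 3), ∀ z ∈ Finset.univ.erase (0 : ZMod L),
      ∑ ξ ∈ Finset.univ.erase (0 : Fin (e + 3) → ZMod L),
        (if ξ ∈ freqBox i z then ((z.valMinAbs : ℝ) ^ 2)⁻¹ else 0) ≤ 3 ^ (e + 2) * (L : ℝ) ^ e := by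
    intro i z hz
    have hz1 : 1 ≤ z.valMinAbs.natAbs := Nat.one_le_iff_ne_zero.2 fun h =>
      Finset.ne_of_mem_erase hz ((ZMod.valMinAbs_eq_zero _).1 (Int.natAbs_eq_zero.1 h))
    have hzL : z.valMinAbs.natAbs ≤ L := (ZMod.natAbs_valMinAbs_le z).trans (Nat.div_le_self _ _)
    have hsq : (z.valMinAbs : ℝ) ^ 2 = (z.valMinAbs.natAbs : ℝ) ^ 2 := by
      rw [Nat.cast_natAbs, Int.cast_abs, sq_abs]
    have hcard := card_freqBox_le i z
    set q := z.valMinAbs.natAbs with hq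
    have hq1 : (1 : ℝ) ≤ q := by exact_mod_cast hz1
    have hcard' : (#(freqBox i z) : ℝ) ≤ (3 * q) ^ (e + 2) := by
      have h1 : (#(freqBox i z) : ℝ) ≤ (2 * q + 1) ^ (e + 2) := by exact_mod_cast hcard
      exact h1.trans (pow_le_pow_left₀ (by positivity) (by linarith) _)
    calc _ ≤ ∑ ξ, (if ξ ∈ freqBox i z then ((z.valMinAbs : ℝ) ^ 2)⁻¹ else 0) :=
          Finset.sum_le_sum_of_subset_of_nonneg (Finset.subset_univ _) fun ξ _ _ => by
            split_ifs <;> positivity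
      _ = #(freqBox i z) * ((q : ℝ) ^ 2)⁻¹ := by
          rw [Finset.sum_ite_mem, Finset.univ_inter, Finset.sum_const, nsmul_eq_mul, hsq]
      _ ≤ (3 * q) ^ (e + 2) * ((q : ℝ) ^ 2)⁻¹ := by gcongr
      _ = 3 ^ (e + 2) * (q : ℝ) ^ e := by rw [mul_pow, pow_add (q : ℝ)]; field_simp
      _ ≤ _ := by gcongr
  calc _ ≤ ∑ ξ ∈ Finset.univ.erase (0 : Fin (e + 3) → ZMod L), ∑ i,
        ∑ z ∈ Finset.univ.erase (0 : ZMod L),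
          (if ξ ∈ freqBox i z then ((z.valMinAbs : ℝ) ^ 2)⁻¹ else 0) :=
        Finset.sum_le_sum fun ξ hξ => inv_freqSq_le (Finset.ne_of_mem_erase hξ)
    _ = ∑ i, ∑ z ∈ Finset.univ.erase (0 : ZMod L),
          ∑ ξ ∈ Finset.univ.erase (0 : Fin (e + 3) → ZMod L),
          (if ξ ∈ freqBox i z then ((z.valMinAbs : ℝ) ^ 2)⁻¹ else 0) := by
        rw [Finset.sum_comm]
        exact Finset.sum_congr rfl fun i _ => Finset.sum_comm
    _ ≤ ∑ i : Fin (e + 3), ∑ z ∈ Finset.univ.erase (0 : ZMod L), 3 ^ (e + 2) * (L : ℝ) ^ e :=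
        Finset.sum_le_sum fun i _ => Finset.sum_le_sum (hz i)
    _ ≤ ∑ i : Fin (e + 3), ∑ z : ZMod L, 3 ^ (e + 2) * (L : ℝ) ^ e :=
        Finset.sum_le_sum fun i _ => Finset.sum_le_sum_of_subset_of_nonneg
          (Finset.subset_univ _) fun _ _ _ => by positivity
    _ = _ := by
        simp only [Finset.sum_const, Finset.card_univ, Fintype.card_fin, ZMod.card, nsmul_eq_mul]
        rw [show e + 3 - 2 = e + 1 by omega, show e + 3 - 1 = e + 2 by omega]
        push_cast
        ring

variable {d : ℕ}

/-- The frequency of a character of the torus. -/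
def charFreq (ψ : AddChar (Fin d → ZMod L) ℂ) (i : Fin d) : ZMod L :=
  AddChar.zmodAddEquiv.symm (ψ.compAddMonoidHom (AddMonoidHom.single (fun _ => ZMod L) i))

theorem zmodAddEquiv_charFreq (ψ : AddChar (Fin d → ZMod L) ℂ) (i : Fin d) :
    AddChar.zmodAddEquiv (charFreq ψ i) =
      ψ.compAddMonoidHom (AddMonoidHom.single (fun _ => ZMod L) i) :=
  AddEquiv.apply_symm_apply _ _

theorem charFreq_injective :
    Function.Injective (charFreq : AddChar (Fin d → ZMod L) ℂ → Fin d → ZMod L) := by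
  intro ψ φ h
  have h1 : ∀ i (z : ZMod L), ψ (Pi.single i z) = φ (Pi.single i z) := fun i z => by
    have h2 := zmodAddEquiv_charFreq ψ i
    rw [h, zmodAddEquiv_charFreq φ i] at h2
    exact (DFunLike.congr_fun h2 z).symm
  have h3 : ψ.toAddMonoidHom = φ.toAddMonoidHom := AddMonoidHom.functions_ext _ _ _ h1
  exact DFunLike.ext _ _ fun v => DFunLike.congr_fun h3 v

theorem charFreq_zero : charFreq (0 : AddChar (Fin d → ZMod L) ℂ) = 0 := by
  ext i
  rw [charFreq, AddEquiv.symm_apply_eq]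
  simp
  rfl

theorem char_single_re (ψ : AddChar (Fin d → ZMod L) ℂ) (i : Fin d) :
    (ψ (Pi.single i 1)).re = Real.cos (2 * Real.pi * ((charFreq ψ i).valMinAbs / L)) := by
  have h : ψ (Pi.single i 1) = AddChar.zmod L (charFreq ψ i) 1 :=
    (DFunLike.congr_fun (zmodAddEquiv_charFreq ψ i) 1).symm
  have h2 := AddChar.zmod_intCast L (charFreq ψ i).valMinAbs 1
  rw [ZMod.coe_valMinAbs, Int.cast_one, Int.cast_one, mul_one] at h2
  rw [h, h2, Circle.coe_exp, Complex.exp_ofReal_mul_I_re]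

theorem char_single_re_le (ψ : AddChar (Fin d → ZMod L) ℂ) (i : Fin d) :
    8 / (L : ℝ) ^ 2 * ((charFreq ψ i).valMinAbs : ℝ) ^ 2 ≤ 1 - (ψ (Pi.single i 1)).re := by
  have hL : (0 : ℝ) < L := by exact_mod_cast Nat.pos_of_neZero L
  rw [char_single_re]
  set x := (charFreq ψ i).valMinAbs with hx
  have h := ZMod.natAbs_valMinAbs_le (charFreq ψ i)
  have h1 : |(x : ℝ)| ≤ L / 2 := by
    have h2 : 2 * x.natAbs ≤ L := by omega
    have h3 : (2 * x.natAbs : ℝ) ≤ L := by exact_mod_cast h2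
    rw [Nat.cast_natAbs, Int.cast_abs] at h3
    linarith
  have h4 : |2 * Real.pi * (x / L)| ≤ Real.pi := by
    rw [abs_mul, abs_div, abs_of_pos hL, abs_of_pos (by positivity : 0 < 2 * Real.pi)]
    have h5 : |(x : ℝ)| / L ≤ 1 / 2 := by rw [div_le_iff₀ hL]; linarith
    nlinarith [Real.pi_pos]
  have h6 := Real.cos_le_one_sub_mul_cos_sq h4
  have h7 : 2 / Real.pi ^ 2 * (2 * Real.pi * (x / L)) ^ 2 = 8 / (L : ℝ) ^ 2 * (x : ℝ) ^ 2 := by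
    field_simp
    ring
  linarith

theorem freqSq_le_charGap (hL : 2 ≤ L) (ψ : AddChar (Fin d → ZMod L) ℂ) :
    8 / (L : ℝ) ^ 2 * freqSq (charFreq ψ) ≤ charGap (torusSteps L d) ψ := by
  have : Fact (1 < L) := ⟨hL⟩
  have hinj : Function.Injective fun i : Fin d => (Pi.single i 1 : Fin d → ZMod L) := by
    intro i j h
    by_contra hij
    have := congr_fun h i
    simp [hij] at this
  have h1 : ∑ i : Fin d, (1 - (ψ (Pi.single i 1)).re) ≤ charGap (torusSteps L d) ψ := by
    rw [← Finset.sum_image (f := fun s => 1 - (ψ s).re) hinj.injOn]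
    exact Finset.sum_le_sum_of_subset_of_nonneg Finset.subset_union_left fun s _ _ => by
      linarith [(abs_le.1 (abs_char_re_le_one ψ s)).2]
  refine le_trans ?_ h1
  rw [freqSq, Finset.mul_sum]
  exact Finset.sum_le_sum fun i _ => char_single_re_le ψ i

theorem charFreq_ne_zero {ψ : AddChar (Fin d → ZMod L) ℂ} (hψ : ψ ≠ 0) : charFreq ψ ≠ 0 :=
  fun h => hψ (charFreq_injective (h.trans charFreq_zero.symm))

theorem le_charGap (hL : 2 ≤ L) {ψ : AddChar (Fin d → ZMod L) ℂ} (hψ : ψ ≠ 0) :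
    8 / (L : ℝ) ^ 2 ≤ charGap (torusSteps L d) ψ :=
  (le_mul_of_one_le_right (by positivity) (one_le_freqSq (charFreq_ne_zero hψ))).trans
    (freqSq_le_charGap hL ψ)

/-- The constant bounding the Green function of the torus. -/
def greenBound (d : ℕ) : ℝ := d * 3 ^ (d - 1) / 8

theorem sum_inv_charGap_le (hL : 2 ≤ L) (hd : 3 ≤ d) :
    ∑ ψ ∈ Finset.univ.erase (0 : AddChar (Fin d → ZMod L) ℂ), (charGap (torusSteps L d) ψ)⁻¹ ≤
      greenBound d * Fintype.card (Fin d → ZMod L) := by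
  have hL0 : (0 : ℝ) < L := by exact_mod_cast Nat.pos_of_neZero L
  calc _ ≤ ∑ ψ ∈ Finset.univ.erase (0 : AddChar (Fin d → ZMod L) ℂ),
        (L : ℝ) ^ 2 / 8 * (freqSq (charFreq ψ))⁻¹ := by
        refine Finset.sum_le_sum fun ψ hψ => ?_
        have h1 := one_le_freqSq (charFreq_ne_zero (Finset.ne_of_mem_erase hψ))
        refine (inv_anti₀ (by positivity) (freqSq_le_charGap hL ψ)).trans (le_of_eq ?_)
        rw [mul_inv, inv_div]
    _ = (L : ℝ) ^ 2 / 8 *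
        ∑ ξ ∈ (Finset.univ.erase (0 : AddChar (Fin d → ZMod L) ℂ)).image charFreq,
          (freqSq ξ)⁻¹ := by
        rw [Finset.sum_image charFreq_injective.injOn, Finset.mul_sum]
    _ ≤ (L : ℝ) ^ 2 / 8 * ∑ ξ ∈ Finset.univ.erase (0 : Fin d → ZMod L), (freqSq ξ)⁻¹ := by
        refine mul_le_mul_of_nonneg_left (Finset.sum_le_sum_of_subset_of_nonneg ?_ ?_)
          (by positivity)
        · intro ξ hξ
          obtain ⟨ψ, hψ, rfl⟩ := Finset.mem_image.1 hξ
          exact Finset.mem_erase.2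
            ⟨charFreq_ne_zero (Finset.ne_of_mem_erase hψ), Finset.mem_univ _⟩
        · exact fun ξ _ _ => inv_nonneg.2 (Finset.sum_nonneg fun i _ => sq_nonneg _)
    _ ≤ (L : ℝ) ^ 2 / 8 * (d * 3 ^ (d - 1) * (L : ℝ) ^ (d - 2)) :=
        mul_le_mul_of_nonneg_left (sum_inv_freqSq_le hd) (by positivity)
    _ = _ := by
        rw [Fintype.card_fun, ZMod.card, Fintype.card_fin, greenBound]
        push_cast
        have h : (L : ℝ) ^ d = L ^ 2 * L ^ (d - 2) := by
          rw [← pow_add, Nat.add_sub_cancel' (by omega)]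
        rw [h]
        ring

theorem sum_inv_charGap_sq_le (hL : 2 ≤ L) (hd : 3 ≤ d) :
    ∑ ψ ∈ Finset.univ.erase (0 : AddChar (Fin d → ZMod L) ℂ),
        (charGap (torusSteps L d) ψ)⁻¹ ^ 2 ≤
      √(greenBound d / (8 * L)) ^ 2 * (Fintype.card (Fin d → ZMod L) : ℝ) ^ 2 := by
  have hL0 : (0 : ℝ) < L := by exact_mod_cast Nat.pos_of_neZero L
  have hL1 : (1 : ℝ) ≤ L := by exact_mod_cast Nat.pos_of_neZero L
  have hB : 0 ≤ greenBound d := by rw [greenBound]; positivity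
  rw [Real.sq_sqrt (by positivity)]
  calc _ ≤ ∑ ψ ∈ Finset.univ.erase (0 : AddChar (Fin d → ZMod L) ℂ),
        (L : ℝ) ^ 2 / 8 * (charGap (torusSteps L d) ψ)⁻¹ := by
        refine Finset.sum_le_sum fun ψ hψ => ?_
        have h1 := le_charGap hL (Finset.ne_of_mem_erase hψ)
        rw [sq]
        refine mul_le_mul_of_nonneg_right ?_ (inv_nonneg.2 (charGap_nonneg ψ))
        refine (inv_anti₀ (by positivity) h1).trans (le_of_eq (inv_div _ _))
    _ ≤ (L : ℝ) ^ 2 / 8 * (greenBound d * Fintype.card (Fin d → ZMod L)) := by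
        rw [← Finset.mul_sum]
        exact mul_le_mul_of_nonneg_left (sum_inv_charGap_le hL hd) (by positivity)
    _ = greenBound d / (8 * L) * ((L : ℝ) ^ 3 * (L : ℝ) ^ d) := by
        rw [Fintype.card_fun, ZMod.card, Fintype.card_fin]
        push_cast
        field_simp
    _ ≤ _ := by
        refine mul_le_mul_of_nonneg_left ?_ (by positivity)
        rw [Fintype.card_fun, ZMod.card, Fintype.card_fin, sq]
        push_cast
        gcongr

end Torus

/-- The torus of dimension at least three and large side carries a rank-like function whose drift
under coalescing walks is as strong as prescribed. -/
theorem exists_isRankLike_drift_torus {d : ℕ} (hd : 3 ≤ d) {B : ℝ} (hB : 0 < B) :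
    ∃ k₁ L₀ : ℕ, ∀ (L : ℕ) [NeZero L], 2 ≤ L → L₀ ≤ L →
      ∃ F : Finset (Fin d → ZMod L) → ℝ, IsRankLike F ∧ ∀ T,
        hopGen (torusGraph L d) F T ≤ -(B / Fintype.card (Fin d → ZMod L)) * (#T - (k₁ : ℕ)) := by
  obtain ⟨τ, hτdef⟩ : ∃ τ, τ = 3 / (8 * B) := ⟨_, rfl⟩
  have hτ : 0 < τ := by rw [hτdef]; positivity
  have hBτ : 3 / (8 * τ) = B := by rw [hτdef]; field_simp
  have hΓ : 0 ≤ greenBound d := by rw [greenBound]; positivity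
  set Γ := greenBound d with hΓdef
  obtain ⟨k, hk⟩ := exists_nat_ge (16 * (Γ / τ + 2))
  obtain ⟨D, hD⟩ : ∃ D, D = (k : ℝ) ^ 2 * (1 + Γ / τ) ^ 2 / τ +
    (k : ℝ) ^ 3 * (1 + Γ / τ) ^ 3 * (2 * d : ℕ) := ⟨_, rfl⟩
  have hΓτ : 0 ≤ Γ / τ := by positivity
  have hD0 : 0 ≤ D := by rw [hD]; positivity
  obtain ⟨L₀, hL₀⟩ := exists_nat_ge (D ^ 2 * Γ / 8)
  refine ⟨2 * k, L₀, fun L _ hL hL₀L => ?_⟩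
  have hL0 : (0 : ℝ) < L := by exact_mod_cast Nat.pos_of_neZero L
  have hsmall : D * √(Γ / (8 * L)) ≤ 1 := by
    refine (sq_le_one_iff₀ (by positivity)).1 ?_
    rw [mul_pow, Real.sq_sqrt (by positivity), ← mul_div_assoc, div_le_one (by positivity)]
    have : (L₀ : ℝ) ≤ L := by exact_mod_cast hL₀L
    linarith
  have h := exists_isRankLike_drift_cayley (V := Fin d → ZMod L) (G := torusGraph L d)
    (N := torusSteps L d) (η := √(Γ / (8 * L))) (torusGraph_adj_iff hL) hτ hΓ (Real.sqrt_nonneg _)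
    (fun ψ hψ => lt_of_lt_of_le (by positivity) (le_charGap hL hψ))
    (sum_inv_charGap_le hL hd) (sum_inv_charGap_sq_le hL hd) hk
    ((mul_le_mul_of_nonneg_right (by
      rw [hD]
      have hc : (#(torusSteps L d) : ℝ) ≤ (2 * d : ℕ) := by exact_mod_cast card_torusSteps_le
      gcongr) (Real.sqrt_nonneg _)).trans hsmall)
  rwa [hBτ] at h

/-- For the KCIP on the torus `Λ(L,d)` with `p = c/n` (`d ≥ 3`): there is an
integer `k₀ ≥ 1` depending only on `c` and `d` such that, with
`K = {x : Σ_v x[v] ≤ k₀}`, for every `C₂ > 0` there exist constants `C₁`, `C` and `N` so that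
for all `n = (L+1)^d > N` and every starting configuration `x`:
`P[Σ_{t=0}^{⌊C₁ n³ log n⌋} 1{X_t ∈ K} < C₂ n³ log n] ≤ C n^{−5}`. -/
theorem kcip_low_occupation_bound (c : ℝ) (hc : 0 < c) (d : ℕ) (hd : 3 ≤ d) :
    ∃ k₀ : ℕ, 1 ≤ k₀ ∧ ∀ C₂ : ℝ, 0 < C₂ → ∃ C₁ C : ℝ, ∃ N : ℕ, 0 < C₁ ∧
      ∀ L : ℕ, N < (L + 1) ^ d →
      ∀ x : (Fin d → ZMod (L + 1)) → Bool,
        trajProb (kcipKernel (torusGraph (L + 1) d) (c / (((L + 1) ^ d : ℕ) : ℝ))) x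
            (⌊C₁ * (((L + 1) ^ d : ℕ) : ℝ) ^ 3 * Real.log (((L + 1) ^ d : ℕ) : ℝ)⌋₊)
            (fun ω =>
              (∑ t : Fin (⌊C₁ * (((L + 1) ^ d : ℕ) : ℝ) ^ 3 *
                    Real.log (((L + 1) ^ d : ℕ) : ℝ)⌋₊ + 1),
                  if numParticles (ω t) ≤ k₀ then (1 : ℝ) else 0) <
                C₂ * (((L + 1) ^ d : ℕ) : ℝ) ^ 3 * Real.log (((L + 1) ^ d : ℕ) : ℝ)) ≤
          C / (((L + 1) ^ d : ℕ) : ℝ) ^ 5 := by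
  obtain ⟨B, hB, hlyap⟩ := exists_kcip_lyapunov (2 * d) hc
  obtain ⟨k₁, L₀, hdrift⟩ := exists_isRankLike_drift_torus hd hB
  obtain ⟨k₀, hk₀, a, b, C, ha, hb, hC, N, hW⟩ := hlyap k₁
  refine ⟨k₀, hk₀, fun C₂ hC₂ => ⟨(6 + (a + b) * C₂) / a, C * Real.exp a,
    max N (max 1 (L₀ ^ d)), by positivity, fun L hL x => ?_⟩⟩
  simp only [max_lt_iff] at hL
  obtain ⟨hNL, h1L, hL₀L⟩ := hL
  have hL1 : 2 ≤ L + 1 := by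
    by_contra h
    obtain rfl : L = 0 := by omega
    simp at h1L
  have hcard : Fintype.card (Fin d → ZMod (L + 1)) = (L + 1) ^ d := by
    rw [Fintype.card_fun, ZMod.card, Fintype.card_fin]
  have hadj := torusGraph_adj_iff (d := d) hL1
  obtain ⟨hp0, hp1, W, hW1, hWC, hout, hin⟩ := hW (Fin d → ZMod (L + 1)) (torusGraph (L + 1) d)
    (by rw [hcard]; exact hNL) (fun v => (card_nbr_cayley hadj v).le.trans card_torusSteps_le)
    (hdrift (L + 1) hL1 (lt_of_pow_lt_pow_left₀ d (Nat.zero_le _) hL₀L).le)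
  rw [hcard] at hp0 hp1 hout hin
  simp only [hcard] at hWC
  set n : ℝ := (((L + 1) ^ d : ℕ) : ℝ) with hn
  have hn1 : 1 ≤ n := by rw [hn]; exact_mod_cast h1L.le
  have hn0 : 0 < n := by linarith
  have hn3 : 1 ≤ n ^ 3 := one_le_pow₀ hn1
  set ℓ := Real.log n with hℓ
  have hexp : Real.exp ℓ = n := Real.exp_log hn0
  set T := ⌊(6 + (a + b) * C₂) / a * n ^ 3 * ℓ⌋₊ with hT
  have hTle : (6 + (a + b) * C₂) / a * n ^ 3 * ℓ - 1 ≤ T := by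
    linarith [Nat.lt_floor_add_one ((6 + (a + b) * C₂) / a * n ^ 3 * ℓ)]
  have hexponent : (a / n ^ 3 + b / n ^ 3) * (C₂ * n ^ 3 * ℓ) - a / n ^ 3 * T ≤ a - 6 * ℓ := by
    have h1 : a / n ^ 3 * ((6 + (a + b) * C₂) / a * n ^ 3 * ℓ - 1) ≤ a / n ^ 3 * T :=
      mul_le_mul_of_nonneg_left hTle (by positivity)
    have h2 : a / n ^ 3 * ((6 + (a + b) * C₂) / a * n ^ 3 * ℓ - 1) =
        (6 + (a + b) * C₂) * ℓ - a / n ^ 3 := by field_simp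
    have h3 : (a / n ^ 3 + b / n ^ 3) * (C₂ * n ^ 3 * ℓ) = (a + b) * C₂ * ℓ := by field_simp
    have h4 : a / n ^ 3 ≤ a := div_le_self ha.le hn3
    linarith
  calc _ ≤ W x * Real.exp ((a / n ^ 3 + b / n ^ 3) * (C₂ * n ^ 3 * ℓ) - a / n ^ 3 * T) := by
        convert trajProb_occupation_lt_le (A := fun y => numParticles y ≤ k₀)
          (kcipKernel_nonneg hp0 hp1) hW1 (by positivity) (by positivity) hout hin T x
    _ ≤ C * n * Real.exp (a - 6 * ℓ) :=
        mul_le_mul (hWC x) (Real.exp_le_exp.2 hexponent) (Real.exp_pos _).le (by positivity)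
    _ = C * Real.exp a / n ^ 5 := by
        rw [Real.exp_sub, show (6 : ℝ) * ℓ = (6 : ℕ) * ℓ by norm_num, Real.exp_nat_mul, hexp]
        field_simp
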